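/- There exist constants c_2 > c_2' > 0 and c, depending only on the weighted graph G, such that if ℓ_0 ≥ c then the following holds. Let n ≥ 0, let 𝒯 ∈ Λ_{n+1}, set x_1 = 𝒯(1), x_2 = 𝒯(2), and U = B(x_1, L_{n+1}/1000) ∪ B(x_2, L_{n+1}/1000) (a disjoint union with disjoint closures). Then for every subset W̃ ⊆ B(x_1, L_{n+1}/2000) ∪ B(x_2, L_{n+1}/2000), every x ∈ ∂U ∪ ∂_int U, and every x' ∈ W̃: c_2'·L_{n+1}^{−ν}·e_{W̃}(x') ≤ P_x[H_{W̃} < ∞ and X_{H_{W̃}} = x'] ≤ c_2·L_{n+1}^{−ν}·e_{W̃}(x'). -/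

import Mathlib

open MeasureTheory Filter Set
open scoped ENNReal NNReal Topology Classical

noncomputable section

/-- The weighted graph `G`: an infinite connected graph of bounded degree, with a weight
`ρG` which is uniformly bounded and uniformly positive on edges, `α`-Ahlfors regular. -/
structure GraphSetup where
  V : Type
  infV : Infinite V
  adjG : V → V → Prop
  adjG_symm : ∀ {y y'}, adjG y y' → adjG y' y
  adjG_irrefl : ∀ y, ¬adjG y y
  /-- `dG` is the graph distance on `G`; this characterization also encodes connectedness. -/
  dG : V → V → ℕ
  dG_spec : ∀ (y y' : V) (n : ℕ), dG y y' ≤ n ↔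
    ∃ p : ℕ → V, p 0 = y ∧ p n = y' ∧ ∀ i < n, p i = p (i + 1) ∨ adjG (p i) (p (i + 1))
  ballG_fin : ∀ (y : V) (R : ℝ), {y' | (dG y y' : ℝ) ≤ R}.Finite
  degBound : ℕ
  deg_fin : ∀ y : V, {y' | adjG y y'}.Finite
  deg_le : ∀ y : V, Nat.card {y' // adjG y y'} ≤ degBound
  ρG : V → V → ℝ
  ρG_symm : ∀ y y', ρG y y' = ρG y' y
  ρG_nonneg : ∀ y y', 0 ≤ ρG y y'
  ρG_pos_iff : ∀ y y', 0 < ρG y y' ↔ adjG y y'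
  ρG_lbd : ℝ
  ρG_ubd : ℝ
  ρG_lbd_pos : 0 < ρG_lbd
  ρG_bounds : ∀ y y', adjG y y' → ρG_lbd ≤ ρG y y' ∧ ρG y y' ≤ ρG_ubd
  α : ℝ
  β : ℝ
  α_gt_one : 1 < α
  β_ge_two : 2 ≤ β
  β_le_α_add_one : β ≤ α + 1
  cA : ℝ
  cA' : ℝ
  cA_pos : 0 < cA
  /-- `α`-Ahlfors regularity of `(G, ρG)`, lower bound. -/
  ahlfors_lb : ∀ (y : V) (R : ℝ), 1 / 2 ≤ R →
    cA * R ^ α ≤ ∑ y' ∈ (ballG_fin y R).toFinset, ∑' y'', ρG y' y''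
  /-- `α`-Ahlfors regularity of `(G, ρG)`, upper bound. -/
  ahlfors_ub : ∀ (y : V) (R : ℝ), 1 / 2 ≤ R →
    (∑ y' ∈ (ballG_fin y R).toFinset, ∑' y'', ρG y' y'') ≤ cA' * R ^ α

namespace GraphSetup

/-- The product graph `E = G × ℤ`. -/
abbrev E (S : GraphSetup) : Type := S.V × ℤ

instance (S : GraphSetup) : MeasurableSpace S.V := ⊤

/-- The exponent `ν = α - β/2`. -/
def ν (S : GraphSetup) : ℝ := S.α - S.β / 2

/-- Adjacency on `E = G × ℤ`. -/
def adjE (S : GraphSetup) (x x' : S.E) : Prop :=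
  (x.2 = x'.2 ∧ S.adjG x.1 x'.1) ∨ (x.1 = x'.1 ∧ (x.2 - x'.2).natAbs = 1)

/-- The weight on `E`: `ρG` on horizontal edges, `1` on vertical edges. -/
def ρE (S : GraphSetup) (x x' : S.E) : ℝ :=
  if x.2 = x'.2 then S.ρG x.1 x'.1
  else if x.1 = x'.1 ∧ (x.2 - x'.2).natAbs = 1 then 1 else 0

/-- `ρ(x) = Σ_{x' ~ x} ρ_{x,x'}`. -/
def ρEpt (S : GraphSetup) (x : S.E) : ℝ := ∑' x', S.ρE x x'

/-- Transition probability of the walk on `E`. -/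
def ptrans (S : GraphSetup) (x x' : S.E) : ℝ := S.ρE x x' / S.ρEpt x

/-- The metric `d((y,z),(y',z')) = max (d_G(y,y'), |z - z'|^{2/β})` on `E`. -/
def dE (S : GraphSetup) (x x' : S.E) : ℝ :=
  max (S.dG x.1 x'.1 : ℝ) (|(x.2 : ℝ) - (x'.2 : ℝ)| ^ (2 / S.β))

/-- Closed `d`-ball in `E`. -/
def ball (S : GraphSetup) (x : S.E) (r : ℝ) : Set S.E := {x' | S.dE x x' ≤ r}

/-- Vertex boundary `∂U`. -/
def vBoundary (S : GraphSetup) (U : Set S.E) : Set S.E :=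
  {x | x ∉ U ∧ ∃ x' ∈ U, S.adjE x x'}

/-- Closure `U ∪ ∂U`. -/
def cl (S : GraphSetup) (U : Set S.E) : Set S.E := U ∪ S.vBoundary U

/-- Interior vertex boundary `∂_int U`. -/
def intBoundary (S : GraphSetup) (U : Set S.E) : Set S.E :=
  {x | x ∈ U ∧ ∃ x', x' ∉ U ∧ S.adjE x x'}

/-- A nearest-neighbour path of length `n` contained in `A`. -/
def IsPathIn (S : GraphSetup) (A : Set S.E) (p : ℕ → S.E) (n : ℕ) : Prop :=
  (∀ i ≤ n, p i ∈ A) ∧ ∀ i < n, S.adjE (p i) (p (i + 1))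

/-- `B₁` is connected to `B₂` by a nearest-neighbour path contained in `A`. -/
def ConnectsIn (S : GraphSetup) (A B₁ B₂ : Set S.E) : Prop :=
  ∃ (n : ℕ) (p : ℕ → S.E), S.IsPathIn A p n ∧ p 0 ∈ B₁ ∧ p n ∈ B₂

/-- The connected component of `x` inside `A`. -/
def component (S : GraphSetup) (A : Set S.E) (x : S.E) : Set S.E :=
  {x' | S.ConnectsIn A {x} {x'}}

/-- `A` is a connected subset of `E`. -/
def IsConnectedSet (S : GraphSetup) (A : Set S.E) : Prop :=
  ∀ x ∈ A, ∀ x' ∈ A, S.ConnectsIn A {x} {x'}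

/-- `C` separates `A` and `B` in `U`: the graph distance between `A` and `B` exceeds `1`
and every nearest-neighbour path from `∂A` to `∂B` remaining in `U` meets `C`. -/
def Separates (S : GraphSetup) (A B C U : Set S.E) : Prop :=
  (∀ a ∈ A, ∀ b ∈ B, a ≠ b ∧ ¬S.adjE a b) ∧
  ∀ (n : ℕ) (p : ℕ → S.E), (∀ i ≤ n, p i ∈ U) → (∀ i < n, S.adjE (p i) (p (i + 1))) →
    p 0 ∈ S.vBoundary A → p n ∈ S.vBoundary B → ∃ i ≤ n, p i ∈ C

/-- The separation event `S_{x,L}`. -/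
def sepEvent (S : GraphSetup) (x : S.E) (L : ℕ) : Set (Set S.E) :=
  {C | ∃ A₁ A₂ : Set S.E,
    A₁ ⊆ S.cl (S.ball x (3 * L)) ∧ A₂ ⊆ S.cl (S.ball x (3 * L)) ∧
    S.IsConnectedSet A₁ ∧ S.IsConnectedSet A₂ ∧
    (∃ a ∈ A₁, ∃ a' ∈ A₁, (L : ℝ) ≤ S.dE a a') ∧
    (∃ a ∈ A₂, ∃ a' ∈ A₂, (L : ℝ) ≤ S.dE a a') ∧
    S.Separates A₁ A₂ C (S.ball x (5 * L))}

/-- A half-plane of `E = G × ℤ`: the product of a semi-infinite geodesic in `G` with `ℤ`. -/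
structure HalfPlane (S : GraphSetup) where
  ray : ℕ → S.V
  geodesic : ∀ n m : ℕ, S.dG (ray n) (ray m) = Nat.dist n m

/-- The set of points of a half-plane. -/
def HalfPlane.carrier {S : GraphSetup} (P : S.HalfPlane) : Set S.E :=
  {x | ∃ n, x.1 = P.ray n}

/-- `B₁` is connected to `B₂` by a `*`-path contained in `A ∩ 𝒫`. -/
def StarConnectsIn (S : GraphSetup) (P : S.HalfPlane) (A B₁ B₂ : Set S.E) : Prop :=
  ∃ (n : ℕ) (p : ℕ → S.E),
    (∀ i ≤ n, p i ∈ A ∧ p i ∈ P.carrier) ∧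
    (∀ i < n, p i ≠ p (i + 1) ∧ S.dG (p i).1 (p (i + 1)).1 ≤ 1 ∧
      ((p i).2 - (p (i + 1)).2).natAbs ≤ 1) ∧
    p 0 ∈ B₁ ∧ p n ∈ B₂

/-- An increasing event on `{0,1}^E` (configurations identified with subsets of `E`). -/
def IncreasingEvent (S : GraphSetup) (A : Set (Set S.E)) : Prop :=
  ∀ C C' : Set S.E, C ⊆ C' → C ∈ A → C' ∈ A

/-- A decreasing event on `{0,1}^E`. -/
def DecreasingEvent (S : GraphSetup) (A : Set (Set S.E)) : Prop :=
  ∀ C C' : Set S.E, C' ⊆ C → C ∈ A → C' ∈ A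

/-- The event `A` only depends on the coordinates in `B`. -/
def DependsOn (S : GraphSetup) (A : Set (Set S.E)) (B : Set S.E) : Prop :=
  ∀ C C' : Set S.E, C ∩ B = C' ∩ B → (C ∈ A ↔ C' ∈ A)

/-- The family `(G_{x,L})` cascades with complexity at most `lam`, with constant `c`. -/
def CascadesLe (S : GraphSetup) (Gf : S.E → ℕ → Set (Set S.E)) (lam c : ℝ) : Prop :=
  (∀ (x : S.E) (L : ℕ), 1 ≤ L → S.DependsOn (Gf x L) (S.ball x (10 * L))) ∧
  ∀ (ℓ : ℕ) (x : S.E) (L : ℕ), 1 ≤ L → 0 < ℓ → 100 ∣ ℓ →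
    ∃ Λ : Finset S.E, ↑Λ ⊆ S.ball x (9 * ℓ * L) ∧ (Λ.card : ℝ) ≤ c * (ℓ : ℝ) ^ lam ∧
      Gf x (ℓ * L) ⊆
        ⋃ x' ∈ Λ, ⋃ x'' ∈ Λ,
          ⋃ (_ : ((ℓ * L : ℕ) : ℝ) / 100 ≤ S.dE x' x''), Gf x' L ∩ Gf x'' L

/-- The length scales `L_n = ℓ₀ⁿ L₀`. -/
def Lscale (ℓ₀ L₀ n : ℕ) : ℕ := ℓ₀ ^ n * L₀

/-- Membership in `Λ_n`: an embedding of the dyadic tree of depth `n` in `E`,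
with nested balls and spread-out children. -/
def IsTreeEmbed (S : GraphSetup) (ℓ₀ L₀ n : ℕ) (T : ∀ k : ℕ, (Fin k → Bool) → S.E) : Prop :=
  ∀ k < n, ∀ (m : Fin k → Bool) (b : Bool),
    S.ball (T (k + 1) (Fin.snoc m b)) (10 * Lscale ℓ₀ L₀ (n - (k + 1))) ⊆
        S.ball (T k m) (10 * Lscale ℓ₀ L₀ (n - k)) ∧
      ((Lscale ℓ₀ L₀ (n - k) : ℝ)) / 100 ≤
        S.dE (T (k + 1) (Fin.snoc m false)) (T (k + 1) (Fin.snoc m true))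

/-- The factor `1 + c₁ √K (k+1)^{-3/2} ℓ₀^{-(ν-ν')/2}`. -/
def decFactor (c₁ K νv ν' : ℝ) (ℓ₀ : ℕ) (k : ℕ) : ℝ :=
  1 + c₁ * Real.sqrt K * ((k : ℝ) + 1) ^ (-(3 : ℝ) / 2) * (ℓ₀ : ℝ) ^ (-(νv - ν') / 2)

/-- The increasing sequence of levels `u_n⁺`. -/
def uPlusSeq (c₁ K νv ν' : ℝ) (ℓ₀ : ℕ) (u₀ : ℝ) (n : ℕ) : ℝ :=
  (∏ k ∈ Finset.range n, decFactor c₁ K νv ν' ℓ₀ k) * u₀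

/-- The decreasing sequence of levels `u_n⁻`. -/
def uMinusSeq (c₁ K νv ν' : ℝ) (ℓ₀ : ℕ) (u₀ : ℝ) (n : ℕ) : ℝ :=
  (∏ k ∈ Finset.range n, (decFactor c₁ K νv ν' ℓ₀ k)⁻¹) * u₀

/-- The limit `u_∞⁺` of `u_n⁺`. -/
def uPlusInf (c₁ K νv ν' : ℝ) (ℓ₀ : ℕ) (u₀ : ℝ) : ℝ := ⨆ n, uPlusSeq c₁ K νv ν' ℓ₀ u₀ n

/-- The limit `u_∞⁻` of `u_n⁻`. -/
def uMinusInf (c₁ K νv ν' : ℝ) (ℓ₀ : ℕ) (u₀ : ℝ) : ℝ := ⨅ n, uMinusSeq c₁ K νv ν' ℓ₀ u₀ n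

/-- The error term `ε(u) = 2 e^{-K u L₀^ν ℓ₀^{ν'}} / (1 - e^{-K u L₀^ν ℓ₀^{ν'}})`. -/
def epsDecouple (K u : ℝ) (L₀ ℓ₀ : ℕ) (νv ν' : ℝ) : ℝ :=
  2 * Real.exp (-(K * u * (L₀ : ℝ) ^ νv * (ℓ₀ : ℝ) ^ ν')) /
    (1 - Real.exp (-(K * u * (L₀ : ℝ) ^ νv * (ℓ₀ : ℝ) ^ ν')))

/-- The canonical law of the random walk on `E`, as a family of measures on trajectories. -/
structure WalkLaw (S : GraphSetup) where
  P : S.E → Measure (ℕ → S.E)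
  isProb : ∀ x, IsProbabilityMeasure (P x)
  cyl : ∀ (x : S.E) (n : ℕ) (q : ℕ → S.E), q 0 = x →
    P x {w | ∀ i ≤ n, w i = q i} =
      ENNReal.ofReal (∏ i ∈ Finset.range n, S.ptrans (q i) (q (i + 1)))
  cyl0 : ∀ (x : S.E) (q : ℕ → S.E), q 0 ≠ x → P x {w | w 0 = q 0} = 0

instance {S : GraphSetup} (W : WalkLaw S) (x : S.E) : IsProbabilityMeasure (W.P x) :=
  W.isProb x

namespace WalkLaw

variable {S : GraphSetup}

/-- `P_x[H_K < ∞]`, the probability to ever enter `K`. -/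
def hitProb (W : WalkLaw S) (x : S.E) (K : Set S.E) : ℝ≥0∞ := W.P x {w | ∃ n, w n ∈ K}

/-- `P_x[H̃_K = ∞]`, the probability never to hit `K` at a positive time. -/
def escProb (W : WalkLaw S) (x : S.E) (K : Set S.E) : ℝ≥0∞ :=
  W.P x {w | ∀ n, 1 ≤ n → w n ∉ K}

/-- `P_x[H_K < ∞, X_{H_K} = x']`, the probability to enter `K` for the first time at `x'`. -/
def entersAt (W : WalkLaw S) (x : S.E) (K : Set S.E) (x' : S.E) : ℝ≥0∞ :=
  W.P x {w | ∃ n, w n = x' ∧ ∀ m < n, w m ∉ K}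

/-- The equilibrium measure `e_K`. -/
def equilibrium (W : WalkLaw S) (K : Set S.E) (x : S.E) : ℝ :=
  if x ∈ K then (W.escProb x K).toReal * S.ρEpt x else 0

/-- The capacity `cap(K) = Σ_{x ∈ K} P_x[H̃_K = ∞] ρ(x)`. -/
def capacity (W : WalkLaw S) (K : Set S.E) : ℝ :=
  ∑' x : K, (W.escProb x.1 K).toReal * S.ρEpt x.1

/-- The Green density `g(x,x') = Σ_{n ≥ 0} P_x[X_n = x'] / ρ(x')`. -/
def green (W : WalkLaw S) (x x' : S.E) : ℝ :=
  (∑' n : ℕ, (W.P x {w | w n = x'}).toReal) / S.ρEpt x'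

/-- The standing assumption `c (d(x,x') ∨ 1)^{-ν} ≤ g(x,x') ≤ c' (d(x,x') ∨ 1)^{-ν}`. -/
def GreenBounds (W : WalkLaw S) (cg cg' : ℝ) : Prop :=
  0 < cg ∧ cg ≤ cg' ∧ ∀ x x' : S.E,
    cg * (max (S.dE x x') 1) ^ (-S.ν) ≤ W.green x x' ∧
      W.green x x' ≤ cg' * (max (S.dE x x') 1) ^ (-S.ν)

end WalkLaw

/-- Random interlacements on `E`, encoded by their canonical probability space and the
family of interlacement sets `ℐ^u`, `u ≥ 0`, with
`ℙ[𝒱^u ⊇ K] = exp(-u cap(K))` for all finite `K`. -/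
structure Interlacement (S : GraphSetup) (W : WalkLaw S) where
  Ω : Type
  mΩ : MeasurableSpace Ω
  prob : @Measure Ω mΩ
  isProb : IsProbabilityMeasure prob
  I : ℝ → Ω → Set S.E
  I_mono : ∀ u u' : ℝ, u ≤ u' → ∀ ω, I u ω ⊆ I u' ω
  vacant_law : ∀ u : ℝ, 0 ≤ u → ∀ K : Set S.E, K.Finite →
    prob {ω | Disjoint K (I u ω)} = ENNReal.ofReal (Real.exp (-(u * W.capacity K)))

namespace Interlacement

variable {S : GraphSetup} {W : WalkLaw S}

/-- The vacant set `𝒱^u = E ∖ ℐ^u`. -/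
def vacant (RI : Interlacement S W) (u : ℝ) (ω : RI.Ω) : Set S.E := (RI.I u ω)ᶜ

/-- The event that `x` lies in an infinite connected component of `𝒱^u`. -/
def percolates (RI : Interlacement S W) (x : S.E) (u : ℝ) : Set RI.Ω :=
  {ω | (S.component (RI.vacant u ω) x).Infinite}

/-- The one-arm event: `B(x,L)` is connected to `∂_int B(x,2L)` in `𝒱^u`. -/
def oneArm (RI : Interlacement S W) (x : S.E) (L : ℝ) (u : ℝ) : Set RI.Ω :=
  {ω | S.ConnectsIn (RI.vacant u ω) (S.ball x L) (S.intBoundary (S.ball x (2 * L)))}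

/-- `sup_{x ∈ E} ℙ[B(x,L) ↔ ∂_int B(x,2L) in 𝒱^u]`. -/
def oneArmSup (RI : Interlacement S W) (u : ℝ) (L : ℕ) : ℝ≥0∞ :=
  ⨆ x : S.E, RI.prob (RI.oneArm x L u)

/-- The set defining `u_*`. -/
def uStarSet (RI : Interlacement S W) : Set ℝ :=
  {u | 0 ≤ u ∧ ∀ x : S.E, RI.prob (RI.percolates x u) = 0}

/-- The critical level `u_*`. -/
def uStar (RI : Interlacement S W) : ℝ := sInf RI.uStarSet

/-- The set defining `u_**`. -/
def uStarStarSet (RI : Interlacement S W) : Set ℝ :=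
  {u | 0 ≤ u ∧ Filter.liminf (fun L : ℕ => RI.oneArmSup u L) Filter.atTop = 0}

/-- The critical level `u_**`. -/
def uStarStar (RI : Interlacement S W) : ℝ := sInf RI.uStarStarSet

/-- The `*`-crossing event for `ℐ^u` inside a half-plane. -/
def starCross (RI : Interlacement S W) (P : S.HalfPlane) (x : S.E) (L : ℝ) (u : ℝ) :
    Set RI.Ω :=
  {ω | S.StarConnectsIn P (RI.I u ω) (S.ball x L) (S.intBoundary (S.ball x (2 * L)))}

/-- `sup_{𝒫, x ∈ 𝒫} ℙ[B(x,L) ↔* ∂_int B(x,2L) in ℐ^u ∩ 𝒫]`. -/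
def starSup (RI : Interlacement S W) (u : ℝ) (L : ℕ) : ℝ≥0∞ :=
  ⨆ P : S.HalfPlane, ⨆ x : P.carrier, RI.prob (RI.starCross P x.1 L u)

/-- The set defining `ũ`. -/
def uTildeSet (RI : Interlacement S W) : Set ℝ :=
  {u | 0 ≤ u ∧ 0 < Filter.liminf (fun L : ℕ => RI.starSup u L) Filter.atTop}

/-- The critical level `ũ`. -/
def uTilde (RI : Interlacement S W) : ℝ := sInf RI.uTildeSet

/-- For an event `A` on `{0,1}^E`, the event `A^u` that the indicator of `ℐ^u` lies in `A`. -/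
def eventAt (RI : Interlacement S W) (A : Set (Set S.E)) (u : ℝ) : Set RI.Ω :=
  {ω | RI.I u ω ∈ A}

end Interlacement

end GraphSetup

open GraphSetup

namespace GraphSetup

section Metric

variable (S : GraphSetup)

theorem dG_self (y : S.V) : S.dG y y = 0 :=
  Nat.le_zero.1 ((S.dG_spec y y 0).2 ⟨fun _ => y, rfl, rfl, by simp⟩)

theorem dG_comm_le (y y' : S.V) : S.dG y' y ≤ S.dG y y' := by
  obtain ⟨p, h0, hn, hp⟩ := (S.dG_spec y y' _).1 le_rfl
  refine (S.dG_spec y' y _).2 ⟨fun i => p (S.dG y y' - i), by simpa using hn, by simpa using h0, ?_⟩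
  intro i hi
  have h := hp (S.dG y y' - (i + 1)) (by omega)
  rw [show S.dG y y' - (i + 1) + 1 = S.dG y y' - i by omega] at h
  exact h.imp Eq.symm fun h => S.adjG_symm h

theorem dG_comm (y y' : S.V) : S.dG y y' = S.dG y' y :=
  le_antisymm (S.dG_comm_le y' y) (S.dG_comm_le y y')

theorem dG_triangle (a b c : S.V) : S.dG a c ≤ S.dG a b + S.dG b c := by
  obtain ⟨p, p0, pn, hp⟩ := (S.dG_spec a b _).1 le_rfl
  obtain ⟨q, q0, qn, hq⟩ := (S.dG_spec b c _).1 le_rfl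
  refine (S.dG_spec a c _).2
    ⟨fun i => if i ≤ S.dG a b then p i else q (i - S.dG a b), by simpa using p0, ?_, ?_⟩
  · by_cases h : S.dG b c = 0
    · simp only [h, add_zero, le_refl, if_true]
      rw [h] at qn
      rw [pn, ← q0, qn]
    · have : ¬ S.dG a b + S.dG b c ≤ S.dG a b := by omega
      simp [this, qn]
  · intro i hi
    rcases lt_trichotomy i (S.dG a b) with h | h | h
    · simpa [h.le, Nat.succ_le_of_lt h] using hp i h
    · have := hq 0 (by omega)
      subst h
      simpa [pn, q0] using this
    · have := hq (i - S.dG a b) (by omega)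
      rw [show i - S.dG a b + 1 = i + 1 - S.dG a b by omega] at this
      have h1 : ¬ i ≤ S.dG a b := by omega
      have h2 : ¬ i + 1 ≤ S.dG a b := by omega
      simpa [h1, h2] using this

theorem dG_le_one {y y' : S.V} (h : S.adjG y y') : S.dG y y' ≤ 1 :=
  (S.dG_spec y y' 1).2 ⟨fun i => if i = 0 then y else y', by simp, by simp, by simp [h]⟩

/-- Points of `G` can be interpolated along a shortest path. -/
theorem exists_dG_split {y y' : S.V} {m n : ℕ} (h : S.dG y y' ≤ m + n) :
    ∃ v, S.dG y v ≤ m ∧ S.dG v y' ≤ n := by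
  obtain ⟨p, p0, pn, hp⟩ := (S.dG_spec y y' _).1 h
  refine ⟨p m, (S.dG_spec _ _ _).2 ⟨p, p0, rfl, fun i hi => hp i (by omega)⟩,
    (S.dG_spec _ _ _).2 ⟨fun i => p (m + i), rfl, pn, fun i hi => hp (m + i) (by omega)⟩⟩

theorem exists_dG_eq (y : S.V) (k : ℕ) : ∃ v, S.dG y v = k := by
  have := S.infV
  obtain ⟨w, hw⟩ := (S.ballG_fin y k).exists_notMem
  have hw : k < S.dG y w := by simpa using hw
  obtain ⟨v, h1, h2⟩ := S.exists_dG_split (m := k) (n := S.dG y w - k) (y := y) (y' := w) (by omega)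
  have := S.dG_triangle y v w
  exact ⟨v, by omega⟩

theorem β_pos : 0 < S.β := lt_of_lt_of_le (by norm_num) S.β_ge_two

theorem two_div_β_pos : 0 < 2 / S.β := div_pos two_pos S.β_pos

theorem ν_pos : 0 < S.ν := by
  have := S.α_gt_one
  have := S.β_le_α_add_one
  unfold ν
  linarith

theorem dE_nonneg (x y : S.E) : 0 ≤ S.dE x y := le_max_of_le_left (Nat.cast_nonneg _)

theorem dE_self (x : S.E) : S.dE x x = 0 := by
  simp [dE, dG_self, Real.zero_rpow S.two_div_β_pos.ne']

theorem dE_comm (x y : S.E) : S.dE x y = S.dE y x := by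
  simp only [dE, S.dG_comm x.1, abs_sub_comm (x.2 : ℝ)]

theorem dE_triangle (x y z : S.E) : S.dE x z ≤ S.dE x y + S.dE y z := by
  refine max_le ?_ ?_
  · refine le_trans ?_ (add_le_add (le_max_left _ _) (le_max_left _ _))
    exact_mod_cast S.dG_triangle _ _ _
  · refine le_trans ?_ (add_le_add (le_max_right _ _) (le_max_right _ _))
    refine le_trans (Real.rpow_le_rpow (abs_nonneg _) (abs_sub_le _ (y.2 : ℝ) _)
      S.two_div_β_pos.le) ?_
    exact Real.rpow_add_le_add_rpow (abs_nonneg _) (abs_nonneg _) S.two_div_β_pos.le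
      ((div_le_one S.β_pos).2 S.β_ge_two)

theorem dE_le_one {x y : S.E} (h : S.adjE x y) : S.dE x y ≤ 1 := by
  rcases h with ⟨h, h'⟩ | ⟨h, h'⟩
  · refine max_le ?_ ?_
    · exact_mod_cast S.dG_le_one h'
    · simp [h, Real.zero_rpow S.two_div_β_pos.ne']
  · refine max_le (by simp [h, dG_self]) ?_
    have : |(x.2 : ℝ) - y.2| = 1 := by
      have : |x.2 - y.2| = 1 := by rw [Int.abs_eq_natAbs, h']; rfl
      exact_mod_cast this
    simp [this]

/-- Vertical distances: `|z|^{2/β} ≤ s` iff `|z| ≤ s^{β/2}`. -/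
theorem rpow_two_div_β_le {a s : ℝ} (ha : 0 ≤ a) (hs : 0 ≤ s) :
    a ^ (2 / S.β) ≤ s ↔ a ≤ s ^ (S.β / 2) := by
  have h := Real.le_rpow_inv_iff_of_pos ha hs S.two_div_β_pos
  rw [inv_div] at h
  exact h.symm

theorem ball_finite (x : S.E) (r : ℝ) : (S.ball x r).Finite := by
  rcases lt_or_ge r 0 with hr | hr
  · refine Set.Finite.subset Set.finite_empty fun y hy => ?_
    exact absurd (le_trans (S.dE_nonneg x y) hy) (not_le.2 hr)
  refine ((S.ballG_fin x.1 r).prod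
    (Set.finite_Icc (x.2 - ⌈r ^ (S.β / 2)⌉) (x.2 + ⌈r ^ (S.β / 2)⌉))).subset ?_
  rintro y hy
  have hy : S.dE x y ≤ r := hy
  refine ⟨le_trans (le_max_left _ _) hy, ?_⟩
  have h := (S.rpow_two_div_β_le (abs_nonneg _) hr).1 (le_trans (le_max_right _ _) hy)
  have h : |(x.2 : ℝ) - y.2| ≤ ⌈r ^ (S.β / 2)⌉ := h.trans (Int.le_ceil _)
  have h : |x.2 - y.2| ≤ ⌈r ^ (S.β / 2)⌉ := by exact_mod_cast h
  rw [abs_le] at h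
  constructor <;> linarith

end Metric

section Weights

variable (S : GraphSetup)

theorem ρE_comm (x y : S.E) : S.ρE x y = S.ρE y x := by
  unfold ρE
  simp only [S.ρG_symm x.1, eq_comm (a := x.2), eq_comm (a := x.1),
    show (x.2 - y.2).natAbs = (y.2 - x.2).natAbs by omega]

theorem ρE_nonneg (x y : S.E) : 0 ≤ S.ρE x y := by
  unfold ρE
  split_ifs
  exacts [S.ρG_nonneg _ _, zero_le_one, le_rfl]

theorem adjE_of_ρE_ne_zero {x y : S.E} (h : S.ρE x y ≠ 0) : S.adjE x y := by
  unfold ρE at h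
  split_ifs at h with h1 h2
  · exact Or.inl ⟨h1, (S.ρG_pos_iff _ _).1 (lt_of_le_of_ne (S.ρG_nonneg _ _) (Ne.symm h))⟩
  · exact Or.inr h2
  · exact absurd rfl h

theorem support_ρE_finite (x : S.E) : (Function.support (S.ρE x)).Finite :=
  (S.ball_finite x 1).subset fun _ hy => S.dE_le_one (S.adjE_of_ρE_ne_zero hy)

theorem summable_ρE (x : S.E) : Summable (S.ρE x) :=
  summable_of_hasFiniteSupport (S.support_ρE_finite x)

theorem ρE_up (x : S.E) : S.ρE x (x.1, x.2 + 1) = 1 := by simp [ρE]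

theorem ρEpt_pos (x : S.E) : 0 < S.ρEpt x :=
  (S.summable_ρE x).tsum_pos (S.ρE_nonneg x) (x.1, x.2 + 1) (by simp [S.ρE_up])

theorem ptrans_nonneg (x y : S.E) : 0 ≤ S.ptrans x y :=
  div_nonneg (S.ρE_nonneg x y) (S.ρEpt_pos x).le

theorem ptrans_up_pos (x : S.E) : 0 < S.ptrans x (x.1, x.2 + 1) := by
  simp [ptrans, S.ρE_up, S.ρEpt_pos x]

theorem adjE_of_ptrans_ne_zero {x y : S.E} (h : S.ptrans x y ≠ 0) : S.adjE x y :=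
  S.adjE_of_ρE_ne_zero fun h' => h (by simp [ptrans, h'])

theorem hasSum_ptrans (x : S.E) : HasSum (S.ptrans x) 1 := by
  have := (S.summable_ρE x).hasSum.div_const (S.ρEpt x)
  rwa [show (∑' y, S.ρE x y) = S.ρEpt x from rfl, div_self (S.ρEpt_pos x).ne'] at this

/-- Transition probabilities as extended nonnegative numbers. -/
def pE (x y : S.E) : ℝ≥0∞ := ENNReal.ofReal (S.ptrans x y)

/-- The vertex weight as an extended nonnegative number. -/
def wE (x : S.E) : ℝ≥0∞ := ENNReal.ofReal (S.ρEpt x)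

theorem tsum_pE (x : S.E) : ∑' y, S.pE x y = 1 := by
  have h := ENNReal.ofReal_tsum_of_nonneg (S.ptrans_nonneg x) (S.hasSum_ptrans x).summable
  rw [(S.hasSum_ptrans x).tsum_eq, ENNReal.ofReal_one] at h
  exact h.symm

theorem wE_ne_zero (x : S.E) : S.wE x ≠ 0 := by simp [wE, S.ρEpt_pos x]

theorem wE_ne_top (x : S.E) : S.wE x ≠ ∞ := ENNReal.ofReal_ne_top

theorem wE_mul_pE (x y : S.E) : S.wE x * S.pE x y = ENNReal.ofReal (S.ρE x y) := by
  rw [wE, pE, ← ENNReal.ofReal_mul (S.ρEpt_pos x).le, ptrans, mul_div_cancel₀ _ (S.ρEpt_pos x).ne']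

theorem pE_eq (x y : S.E) : S.pE x y = (S.wE x)⁻¹ * ENNReal.ofReal (S.ρE x y) := by
  rw [← wE_mul_pE, ← mul_assoc, ENNReal.inv_mul_cancel (S.wE_ne_zero x) (S.wE_ne_top x), one_mul]

theorem adjE_of_pE_ne_zero {x y : S.E} (h : S.pE x y ≠ 0) : S.adjE x y :=
  S.adjE_of_ptrans_ne_zero fun h' => h (by simp [pE, h'])

end Weights

section Markov

variable {S : GraphSetup}

instance : DiscreteMeasurableSpace S.V := ⟨fun _ => trivial⟩

instance : Countable S.V := by
  have y : S.V := (S.infV.nonempty).some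
  refine Set.countable_univ_iff.1 ((Set.countable_iUnion fun n : ℕ =>
    (S.ballG_fin y n).countable).mono fun v _ => Set.mem_iUnion.2 ⟨S.dG y v, ?_⟩)
  simp

/-- Trajectories agreeing with `q` up to time `n`. -/
def cylinderSet (n : ℕ) (q : ℕ → S.E) : Set (ℕ → S.E) := {w | ∀ i ≤ n, w i = q i}

theorem measurableSet_coord (n : ℕ) (A : Set S.E) : MeasurableSet {w : ℕ → S.E | w n ∈ A} :=
  measurable_pi_apply n (MeasurableSet.of_discrete (s := A))

theorem measurableSet_cylinderSet (n : ℕ) (q : ℕ → S.E) : MeasurableSet (cylinderSet n q) := by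
  have : cylinderSet n q = ⋂ i, ⋂ (_ : i ≤ n), {w : ℕ → S.E | w i ∈ ({q i} : Set S.E)} := by
    ext w; simp [cylinderSet]
  rw [this]
  exact .iInter fun i => .iInter fun _ => measurableSet_coord i _

theorem generateFrom_cylinderSet :
    (inferInstance : MeasurableSpace (ℕ → S.E)) =
      MeasurableSpace.generateFrom {A | ∃ n q, A = cylinderSet (S := S) n q} := by
  refine le_antisymm ?_ (MeasurableSpace.generateFrom_le ?_)
  · refine iSup_le fun n => ?_
    rintro _ ⟨A, -, rfl⟩
    have : (fun w : ℕ → S.E => w n) ⁻¹' A =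
        ⋃ q : Fin (n + 1) → S.E, ⋃ (_ : q (Fin.last n) ∈ A),
          cylinderSet n (fun i => q (Fin.ofNat (n + 1) i)) := by
      ext w
      simp only [Set.mem_preimage, Set.mem_iUnion, cylinderSet, Set.mem_ofPred_eq, exists_prop]
      constructor
      · intro h
        refine ⟨fun i => w i, by simpa using h, fun i hi => ?_⟩
        simp [Fin.ofNat, Nat.mod_eq_of_lt (Nat.lt_succ_of_le hi)]
      · rintro ⟨q, hq, h⟩
        rw [h n le_rfl]
        convert hq
        ext
        simp [Fin.ofNat]
    rw [this]
    refine MeasurableSet.iUnion fun q => MeasurableSet.iUnion fun _ => ?_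
    exact MeasurableSpace.measurableSet_generateFrom ⟨n, _, rfl⟩
  · rintro _ ⟨n, q, rfl⟩
    exact measurableSet_cylinderSet n q

theorem isPiSystem_cylinderSet : IsPiSystem {A | ∃ n q, A = cylinderSet (S := S) n q} := by
  rintro _ ⟨n, q, rfl⟩ _ ⟨m, q', rfl⟩ ⟨w, hw, hw'⟩
  refine ⟨max n m, w, Set.ext fun v => ⟨?_, fun h => ⟨?_, ?_⟩⟩⟩
  · rintro ⟨h, h'⟩ i hi
    rcases le_max_iff.1 hi with hi | hi
    · rw [h i hi, hw i hi]
    · rw [h' i hi, hw' i hi]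
  · exact fun i hi => (h i (le_max_of_le_left hi)).trans (hw i hi)
  · exact fun i hi => (h i (le_max_of_le_right hi)).trans (hw' i hi)

variable (W : WalkLaw S)

theorem WalkLaw.ae_start (x : S.E) : ∀ᵐ w ∂W.P x, w 0 = x := by
  have h := W.cyl x 0 (fun _ => x) rfl
  simp only [Nat.le_zero, forall_eq, Finset.range_zero, Finset.prod_empty,
    ENNReal.ofReal_one] at h
  exact (prob_compl_eq_zero_iff (measurableSet_coord 0 ({x} : Set S.E))).2 h

theorem measurable_shift : Measurable fun (w : ℕ → S.E) n => w (n + 1) :=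
  measurable_pi_lambda _ fun n => measurable_pi_apply (n + 1)

/-- The Markov property at time one, as an identity of measures. -/
theorem WalkLaw.map_shift (x : S.E) :
    (W.P x).map (fun w n => w (n + 1)) = Measure.sum fun z => S.pE x z • W.P z := by
  have hp := Measure.isProbabilityMeasure_map (μ := W.P x) (measurable_shift (S := S)).aemeasurable
  refine ext_of_generate_finite _ generateFrom_cylinderSet isPiSystem_cylinderSet ?_ ?_
  · rintro _ ⟨n, q, rfl⟩
    rw [Measure.map_apply measurable_shift (measurableSet_cylinderSet n q),
      Measure.sum_apply _ (measurableSet_cylinderSet n q)]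
    rw [tsum_eq_single (q 0)]
    · have h1 : W.P x ((fun w n => w (n + 1)) ⁻¹' cylinderSet n q) =
          W.P x {w | ∀ i ≤ n + 1, w i = (fun j => Nat.casesOn j x q : ℕ → S.E) i} := by
        refine measure_congr ?_
        filter_upwards [W.ae_start x] with w hw
        refine propext ⟨fun h i hi => ?_, fun h i hi => h (i + 1) (by omega)⟩
        cases i with
        | zero => exact hw
        | succ i => exact h i (by omega)
      rw [h1, W.cyl x (n + 1) _ rfl, Finset.prod_range_succ', mul_comm,
        ENNReal.ofReal_mul (S.ptrans_nonneg _ _)]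
      simp only [Measure.smul_apply, smul_eq_mul]
      congr 1
      exact (W.cyl (q 0) n q rfl).symm
    · intro z hz
      simp only [Measure.smul_apply, smul_eq_mul]
      rw [measure_mono_null (show cylinderSet n q ⊆ {w | w 0 = q 0} from
        fun w hw => hw 0 (Nat.zero_le _)) (W.cyl0 z q hz.symm), mul_zero]
  · rw [measure_univ, Measure.sum_apply _ MeasurableSet.univ]
    simp [S.tsum_pE]

theorem WalkLaw.prob_shift (x : S.E) {A : Set (ℕ → S.E)} (hA : MeasurableSet A) :
    W.P x {w | (fun n => w (n + 1)) ∈ A} = ∑' z, S.pE x z * W.P z A := by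
  have h := congrArg (fun μ => μ A) (W.map_shift x)
  simp only [Measure.map_apply measurable_shift hA, Measure.sum_apply _ hA,
    Measure.smul_apply, smul_eq_mul] at h
  exact h

end Markov

section Killed

variable (S : GraphSetup) (K : Set S.E)

/-- Density of the `n`-step transition probability of the walk killed on entering `K`. -/
def killed : ℕ → S.E → S.E → ℝ≥0∞
  | 0, x, y => if x = y ∧ x ∉ K then (S.wE x)⁻¹ else 0
  | n + 1, x, y => if x ∈ K then 0 else ∑' z, S.pE x z * killed n z y

theorem killed_zero (x y : S.E) :
    S.killed K 0 x y = if x = y ∧ x ∉ K then (S.wE x)⁻¹ else 0 := rfl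

theorem killed_succ (n : ℕ) (x y : S.E) :
    S.killed K (n + 1) x y = if x ∈ K then 0 else ∑' z, S.pE x z * S.killed K n z y := rfl

theorem killed_of_mem {x : S.E} (hx : x ∈ K) (n : ℕ) (y : S.E) : S.killed K n x y = 0 := by
  cases n <;> simp [killed_zero, killed_succ, hx]

theorem killed_succ_right (n : ℕ) (x y : S.E) :
    S.killed K (n + 1) x y = if y ∈ K then 0 else ∑' z, S.killed K n x z * S.pE y z := by
  induction n generalizing x with
  | zero =>
    rw [killed_succ, tsum_eq_single y, tsum_eq_single x]
    · simp only [killed_zero, true_and]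
      rw [S.pE_eq x y, S.pE_eq y x, S.ρE_comm y x]
      by_cases hx : x ∈ K <;> by_cases hy : y ∈ K <;> simp [hx, hy]
      ring
    · intro z hz
      simp [killed_zero, Ne.symm hz]
    · intro z hz
      simp [killed_zero, hz]
  | succ n ih =>
    rw [killed_succ]
    simp only [ih]
    by_cases hx : x ∈ K
    · simp [hx, killed_of_mem]
    by_cases hy : y ∈ K
    · simp [hy]
    simp only [hx, hy, if_false, killed_succ S K n x]
    simp only [← ENNReal.tsum_mul_left, ← ENNReal.tsum_mul_right]
    rw [ENNReal.tsum_comm]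
    simp only [mul_assoc]

theorem killed_comm (n : ℕ) (x y : S.E) : S.killed K n x y = S.killed K n y x := by
  induction n generalizing x y with
  | zero =>
    by_cases h : x = y
    · rw [h]
    · simp [killed_zero, h, Ne.symm h]
  | succ n ih =>
    rw [killed_succ, killed_succ_right]
    simp only [ih _ y, mul_comm]

theorem killed_le (n : ℕ) (x y : S.E) : S.killed K n x y ≤ S.killed ∅ n x y := by
  induction n generalizing x with
  | zero =>
    rw [killed_zero, killed_zero]
    split_ifs with h h'
    exacts [le_rfl, absurd ⟨h.1, Set.notMem_empty x⟩ h', zero_le, le_rfl]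
  | succ n ih =>
    simp only [killed_succ, Set.mem_empty_iff_false, if_false]
    split_ifs
    · exact zero_le
    · exact ENNReal.tsum_le_tsum fun z => by gcongr; exact ih z

/-- Green density of the walk killed on entering `K`. -/
def greenK (x y : S.E) : ℝ≥0∞ := ∑' n, S.killed K n x y

theorem greenK_comm (x y : S.E) : S.greenK K x y = S.greenK K y x := by
  simp only [greenK, S.killed_comm K _ x y]

theorem greenK_le (x y : S.E) : S.greenK K x y ≤ S.greenK ∅ x y :=
  ENNReal.tsum_le_tsum fun n => S.killed_le K n x y

theorem greenK_of_mem {x : S.E} (hx : x ∈ K) (y : S.E) : S.greenK K x y = 0 := by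
  simp [greenK, S.killed_of_mem K hx]

theorem greenK_step {x : S.E} (hx : x ∉ K) (y : S.E) :
    S.greenK K x y = (if x = y then (S.wE x)⁻¹ else 0) + ∑' z, S.pE x z * S.greenK K z y := by
  rw [greenK, tsum_eq_zero_add' ENNReal.summable]
  simp only [killed_zero, killed_succ, hx, not_false_eq_true, and_true, if_false, greenK,
    ← ENNReal.tsum_mul_left]
  rw [ENNReal.tsum_comm]

theorem tsum_pE_greenK_le {x : S.E} (hx : x ∉ K) (y : S.E) :
    ∑' z, S.pE x z * S.greenK K z y ≤ S.greenK K x y := by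
  rw [S.greenK_step K hx y]
  exact le_add_self

theorem tsum_pE_greenK {x : S.E} (hx : x ∉ K) {y : S.E} (hxy : x ≠ y) :
    ∑' z, S.pE x z * S.greenK K z y = S.greenK K x y := by
  rw [S.greenK_step K hx y, if_neg hxy, zero_add]

/-- Killing on `K` decreases the Green density by at most its supremum over `K`. -/
theorem green_le_greenK_add {y : S.E} {b : ℝ≥0∞} (hb : ∀ k ∈ K, S.greenK ∅ k y ≤ b) (x : S.E) :
    S.greenK ∅ x y ≤ S.greenK K x y + b := by
  have key : ∀ n x, ∑ i ∈ Finset.range n, S.killed ∅ i x y ≤ S.greenK K x y + b := by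
    intro n
    induction n with
    | zero => simp
    | succ n ih =>
      intro x
      by_cases hx : x ∈ K
      · exact (ENNReal.sum_le_tsum _).trans ((hb x hx).trans le_add_self)
      rw [Finset.sum_range_succ', S.greenK_step K hx y]
      have h : ∑ i ∈ Finset.range n, S.killed ∅ (i + 1) x y =
          ∑' z, S.pE x z * ∑ i ∈ Finset.range n, S.killed ∅ i z y := by
        simp only [killed_succ, Set.mem_empty_iff_false, if_false, Finset.mul_sum]
        exact (Summable.tsum_finsetSum fun _ _ => ENNReal.summable).symm
      rw [h, add_comm, add_assoc]
      refine add_le_add (by simp [killed_zero]) ?_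
      calc _ ≤ ∑' z, S.pE x z * (S.greenK K z y + b) :=
            ENNReal.tsum_le_tsum fun z => by gcongr; exact ih z
        _ = _ := by
          simp only [mul_add, ENNReal.tsum_add, ENNReal.tsum_mul_right, S.tsum_pE, one_mul]
  exact ENNReal.tsum_le_of_sum_range_le fun n => key n x

/-- Probability of avoiding `K` during the first `n` steps. -/
def avoid : ℕ → S.E → ℝ≥0∞
  | 0, _ => 1
  | n + 1, x => if x ∈ K then 0 else ∑' z, S.pE x z * avoid n z

theorem avoid_succ (n : ℕ) (x : S.E) :
    S.avoid K (n + 1) x = if x ∈ K then 0 else ∑' z, S.pE x z * S.avoid K n z := rfl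

theorem one_le_avoid_add {v : S.E → ℝ≥0∞} (hv : ∀ k ∈ K, 1 ≤ v k)
    (hs : ∀ x ∉ K, ∑' z, S.pE x z * v z ≤ v x) (n : ℕ) (x : S.E) : 1 ≤ S.avoid K n x + v x := by
  induction n generalizing x with
  | zero => exact le_self_add
  | succ n ih =>
    by_cases hx : x ∈ K
    · exact (hv x hx).trans le_add_self
    rw [avoid_succ, if_neg hx]
    calc (1 : ℝ≥0∞) = ∑' z, S.pE x z * 1 := by simp [S.tsum_pE]
      _ ≤ ∑' z, S.pE x z * (S.avoid K n z + v z) :=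
        ENNReal.tsum_le_tsum fun z => by gcongr; exact ih z
      _ ≤ _ := by
        simp only [mul_add, ENNReal.tsum_add]
        gcongr
        exact hs x hx

end Killed

section WalkLink

variable {S : GraphSetup} (W : WalkLaw S) (K : Set S.E)

theorem measurableSet_avoid (n : ℕ) : MeasurableSet {w : ℕ → S.E | ∀ m < n, w m ∉ K} := by
  have : {w : ℕ → S.E | ∀ m < n, w m ∉ K} = ⋂ m, ⋂ (_ : m < n), {w | w m ∈ Kᶜ} := by ext; simp
  rw [this]
  exact .iInter fun m => .iInter fun _ => measurableSet_coord m _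

theorem measurableSet_firstEntrance (n : ℕ) (y : S.E) :
    MeasurableSet {w : ℕ → S.E | w n = y ∧ ∀ m < n, w m ∉ K} :=
  (measurableSet_coord n ({y} : Set S.E)).inter (measurableSet_avoid K n)

theorem WalkLaw.prob_avoid (n : ℕ) (x : S.E) :
    W.P x {w | ∀ m < n, w m ∉ K} = S.avoid K n x := by
  induction n generalizing x with
  | zero => simp [avoid]
  | succ n ih =>
    rw [avoid_succ]
    split_ifs with hx
    · refine measure_eq_zero_iff_ae_notMem.2 ?_
      filter_upwards [W.ae_start x] with w hw h
      exact h 0 (Nat.succ_pos n) (hw ▸ hx)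
    · simp only [← ih]
      rw [← W.prob_shift x (measurableSet_avoid K n)]
      refine measure_congr ?_
      filter_upwards [W.ae_start x] with w hw
      refine propext ⟨fun h m hm => h (m + 1) (by omega), fun h m hm => ?_⟩
      cases m with
      | zero => exact hw ▸ hx
      | succ m => exact h m (by omega)

/-- Probability never to visit `K`. -/
def escE (x : S.E) : ℝ≥0∞ := W.P x {w | ∀ n, w n ∉ K}

theorem measurableSet_never : MeasurableSet {w : ℕ → S.E | ∀ n, w n ∉ K} := by
  have : {w : ℕ → S.E | ∀ n, w n ∉ K} = ⋂ n, {w | w n ∈ Kᶜ} := by ext; simp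
  rw [this]
  exact .iInter fun n => measurableSet_coord n _

theorem escE_le_one (x : S.E) : escE W K x ≤ 1 := prob_le_one

theorem escE_of_mem {x : S.E} (hx : x ∈ K) : escE W K x = 0 := by
  refine measure_eq_zero_iff_ae_notMem.2 ?_
  filter_upwards [W.ae_start x] with w hw h
  exact h 0 (hw ▸ hx)

theorem escProb_eq (x : S.E) : W.escProb x K = ∑' z, S.pE x z * escE W K z := by
  unfold escE
  rw [← W.prob_shift x (measurableSet_never K), WalkLaw.escProb]
  congr 1
  ext w
  refine ⟨fun h n => h (n + 1) (by omega), fun h n hn => ?_⟩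
  obtain ⟨m, rfl⟩ : ∃ m, n = m + 1 := ⟨n - 1, by omega⟩
  exact h m

theorem escE_step {x : S.E} (hx : x ∉ K) : ∑' z, S.pE x z * escE W K z = escE W K x := by
  rw [← escProb_eq]
  refine measure_congr ?_
  filter_upwards [W.ae_start x] with w hw
  refine propext ⟨fun h n => ?_, fun h n _ => h n⟩
  cases n with
  | zero => exact hw ▸ hx
  | succ n => exact h (n + 1) (by omega)

/-- A superharmonic function that is at least `1` on `K` bounds the hitting probability of `K`. -/
theorem one_le_escE_add {v : S.E → ℝ≥0∞} (hv : ∀ k ∈ K, 1 ≤ v k)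
    (hs : ∀ x ∉ K, ∑' z, S.pE x z * v z ≤ v x) (x : S.E) : 1 ≤ escE W K x + v x := by
  have h : escE W K x = ⨅ n, S.avoid K n x := by
    simp only [← W.prob_avoid]
    have hset : {w : ℕ → S.E | ∀ n, w n ∉ K} = ⋂ n, {w : ℕ → S.E | ∀ m < n, w m ∉ K} := by
      ext w
      simp only [Set.mem_iInter]
      exact ⟨fun h n m _ => h m, fun h n => h (n + 1) n (Nat.lt_succ_self n)⟩
    rw [escE, hset]
    exact Antitone.measure_iInter (fun a b hab w hw m hm => hw m (hm.trans_le hab))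
      (fun n => (measurableSet_avoid K n).nullMeasurableSet) ⟨0, measure_ne_top _ _⟩
  rw [h, ENNReal.iInf_add]
  exact le_iInf fun n => S.one_le_avoid_add K hv hs n x

/-- The equilibrium measure in terms of escape probabilities from the neighbours. -/
theorem ofReal_equilibrium {x : S.E} (hx : x ∈ K) :
    ENNReal.ofReal (W.equilibrium K x) = ∑' z, ENNReal.ofReal (S.ρE x z) * escE W K z := by
  have ht : W.escProb x K ≠ ∞ := measure_ne_top _ _
  rw [WalkLaw.equilibrium, if_pos hx, ENNReal.ofReal_mul ENNReal.toReal_nonneg,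
    ENNReal.ofReal_toReal ht, escProb_eq, mul_comm, ← ENNReal.tsum_mul_left]
  simp only [← mul_assoc, ← S.wE_mul_pE]
  rfl

theorem WalkLaw.prob_first_entrance {y : S.E} (n : ℕ) (x : S.E) :
    W.P x {w | w (n + 1) = y ∧ ∀ m < n + 1, w m ∉ K} =
      ∑' z, S.killed K n x z * ENNReal.ofReal (S.ρE z y) := by
  have step : ∀ n x, W.P x {w | w (n + 1) = y ∧ ∀ m < n + 1, w m ∉ K} =
      if x ∈ K then 0 else ∑' z, S.pE x z * W.P z {w | w n = y ∧ ∀ m < n, w m ∉ K} := by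
    intro n x
    split_ifs with hx
    · refine measure_eq_zero_iff_ae_notMem.2 ?_
      filter_upwards [W.ae_start x] with w hw h
      exact h.2 0 (Nat.succ_pos n) (hw ▸ hx)
    · rw [← W.prob_shift x (measurableSet_firstEntrance K n y)]
      refine measure_congr ?_
      filter_upwards [W.ae_start x] with w hw
      refine propext ⟨fun h => ⟨h.1, fun m hm => h.2 (m + 1) (by omega)⟩,
        fun h => ⟨h.1, fun m hm => ?_⟩⟩
      cases m with
      | zero => exact hw ▸ hx
      | succ m => exact h.2 m (by omega)
  induction n generalizing x with
  | zero =>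
    have hr : ∑' z, S.killed K 0 x z * ENNReal.ofReal (S.ρE z y) =
        S.killed K 0 x x * ENNReal.ofReal (S.ρE x y) :=
      tsum_eq_single x fun z hz => by simp [killed_zero, Ne.symm hz]
    rw [step, hr]
    by_cases hx : x ∈ K
    · simp [hx, killed_of_mem]
    · simp only [hx, if_false, killed_zero, not_false_eq_true, and_self, if_true]
      rw [tsum_eq_single y, ← S.pE_eq]
      · have : W.P y {w | w 0 = y ∧ ∀ m < 0, w m ∉ K} = 1 := by
          have := W.prob_avoid K 0 y
          rw [avoid] at this
          rw [← this]
          refine measure_congr ?_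
          filter_upwards [W.ae_start y] with w hw
          exact propext ⟨fun h => h.2, fun h => ⟨hw, h⟩⟩
        rw [this, mul_one]
      · intro z hz
        have : W.P z {w | w 0 = y ∧ ∀ m < 0, w m ∉ K} = 0 := by
          refine measure_eq_zero_iff_ae_notMem.2 ?_
          filter_upwards [W.ae_start z] with w hw h
          exact hz (hw.symm.trans h.1)
        rw [this, mul_zero]
  | succ n ih =>
    rw [step]
    simp only [ih, killed_succ]
    split_ifs
    · simp
    simp only [← ENNReal.tsum_mul_left, ← ENNReal.tsum_mul_right]
    rw [ENNReal.tsum_comm]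
    simp only [mul_assoc]

/-- Entrance law in terms of the killed Green density. -/
theorem entersAt_eq {x y : S.E} (hx : x ∉ K) (hy : y ∈ K) :
    W.entersAt x K y = ∑' z, S.greenK K z x * ENNReal.ofReal (S.ρE z y) := by
  have hset : {w : ℕ → S.E | ∃ n, w n = y ∧ ∀ m < n, w m ∉ K} =
      ⋃ n, {w | w n = y ∧ ∀ m < n, w m ∉ K} := by ext; simp
  rw [WalkLaw.entersAt, hset, measure_iUnion _ (measurableSet_firstEntrance K · y),
    tsum_eq_zero_add' ENNReal.summable]
  · have : W.P x {w | w 0 = y ∧ ∀ m < 0, w m ∉ K} = 0 := by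
      refine measure_eq_zero_iff_ae_notMem.2 ?_
      filter_upwards [W.ae_start x] with w hw h
      exact hx (hw ▸ h.1 ▸ hy)
    rw [this, zero_add]
    simp only [W.prob_first_entrance K, fun z => S.greenK_comm K z x]
    simp only [greenK, ← ENNReal.tsum_mul_right]
    rw [ENNReal.tsum_comm]
  · intro a b hab
    refine Set.disjoint_left.2 fun w ha hb => ?_
    rcases lt_or_gt_of_ne hab with h | h
    · exact hb.2 a h (ha.1 ▸ hy)
    · exact ha.2 b h (hb.1 ▸ hy)

theorem ofReal_green {x y : S.E} (h : W.green x y ≠ 0) :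
    S.greenK ∅ x y = ENNReal.ofReal (W.green x y) := by
  have hp : ∀ n x, W.P x {w | w n = y} = S.killed ∅ n x y * S.wE y := by
    intro n
    induction n with
    | zero =>
      intro x
      by_cases hxy : x = y
      · subst hxy
        have : W.P x {w | w 0 = x} = 1 := by
          simpa using W.cyl x 0 (fun _ => x) rfl
        simp [this, killed_zero, ENNReal.inv_mul_cancel (S.wE_ne_zero x) (S.wE_ne_top x)]
      · simp only [killed_zero, hxy, false_and, if_false, zero_mul]
        refine measure_eq_zero_iff_ae_notMem.2 ?_
        filter_upwards [W.ae_start x] with w hw h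
        exact hxy (hw.symm.trans h)
    | succ n ih =>
      intro x
      have := W.prob_shift x (measurableSet_coord n ({y} : Set S.E))
      simp only [killed_succ, Set.mem_empty_iff_false, if_false, ← ENNReal.tsum_mul_right,
        mul_assoc, ← ih]
      exact this
  have hs : Summable fun n => (W.P x {w | w n = y}).toReal := by
    by_contra hs
    exact h (by rw [WalkLaw.green, tsum_eq_zero_of_not_summable hs, zero_div])
  rw [WalkLaw.green, ENNReal.ofReal_div_of_pos (S.ρEpt_pos y),
    ENNReal.ofReal_tsum_of_nonneg (fun _ => ENNReal.toReal_nonneg) hs]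
  simp only [ENNReal.ofReal_toReal (measure_ne_top _ _)]
  simp only [hp, ENNReal.tsum_mul_right]
  exact (ENNReal.mul_div_cancel_right (S.wE_ne_zero y) (S.wE_ne_top y)).symm

end WalkLink

section Comparison

variable {S : GraphSetup}

theorem toReal_tsum_pE {F : S.E → ℝ≥0∞} (hF : ∀ x, F x ≠ ∞) (x : S.E) :
    (∑' z, S.pE x z * F z).toReal = ∑' z, S.ptrans x z * (F z).toReal := by
  have h : ∀ z, S.pE x z * F z ≠ ∞ := fun z => ENNReal.mul_ne_top ENNReal.ofReal_ne_top (hF z)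
  rw [ENNReal.tsum_toReal_eq h]
  simp [pE, ENNReal.toReal_ofReal (S.ptrans_nonneg x _)]

theorem summable_ptrans_mul (f : S.E → ℝ) (x : S.E) : Summable fun z => S.ptrans x z * f z :=
  summable_of_hasFiniteSupport ((S.ball_finite x 1).subset fun _ hz =>
    S.dE_le_one (S.adjE_of_ptrans_ne_zero (left_ne_zero_of_mul hz)))

/-- Minimum principle on a finite set. -/
theorem nonneg_of_superharmonic {D : Set S.E} (hD : D.Finite) {f : S.E → ℝ}
    (hsup : ∀ x ∈ D, ∑' z, S.ptrans x z * f z ≤ f x)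
    (hb : ∀ x ∈ D, ∀ z ∉ D, S.adjE x z → 0 ≤ f z) : ∀ x ∈ D, 0 ≤ f x := by
  by_contra! hneg
  obtain ⟨x₀, hx₀, hneg⟩ := hneg
  obtain ⟨a, ha, hmin⟩ := Set.exists_min_image D f hD ⟨x₀, hx₀⟩
  obtain ⟨b, ⟨hb₁, hb₂⟩, hmax⟩ := Set.exists_max_image {x ∈ D | f x = f a} (fun x => x.2)
    (hD.subset fun _ h => h.1) ⟨a, ha, rfl⟩
  have hlt : f b < 0 := by linarith [hmin x₀ hx₀]
  have hle : ∀ z, S.adjE b z → f b ≤ f z := fun z hz => by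
    by_cases h : z ∈ D
    · linarith [hmin z h]
    · linarith [hb b hb₁ z h hz]
  have hup := S.adjE_of_ptrans_ne_zero (S.ptrans_up_pos b).ne'
  have hstrict : f b < f (b.1, b.2 + 1) := by
    refine lt_of_le_of_ne (hle _ hup) fun h => ?_
    by_cases h' : (b.1, b.2 + 1) ∈ D
    · have := hmax (b.1, b.2 + 1) ⟨h', by rw [← h, hb₂]⟩
      simp at this
    · linarith [hb b hb₁ _ h' hup]
  have h := Summable.tsum_lt_tsum (f := fun z => S.ptrans b z * f b)
    (g := fun z => S.ptrans b z * f z) (i := (b.1, b.2 + 1)) (fun z => ?_)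
    (mul_lt_mul_of_pos_left hstrict (S.ptrans_up_pos b))
    (summable_ptrans_mul (fun _ => f b) b) (summable_ptrans_mul f b)
  · rw [tsum_mul_right, (S.hasSum_ptrans b).tsum_eq, one_mul] at h
    linarith [hsup b hb₁]
  · by_cases hz : S.ptrans b z = 0
    · simp [hz]
    · exact mul_le_mul_of_nonneg_left (hle z (S.adjE_of_ptrans_ne_zero hz)) (S.ptrans_nonneg _ _)

/-- Comparison of a subharmonic and a superharmonic function on a finite set. -/
theorem le_of_subharmonic_of_superharmonic {D : Set S.E} (hD : D.Finite) {F H : S.E → ℝ≥0∞}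
    (hF : ∀ x, F x ≠ ∞) (hH : ∀ x, H x ≠ ∞)
    (hsub : ∀ x ∈ D, F x ≤ ∑' z, S.pE x z * F z) (hsup : ∀ x ∈ D, ∑' z, S.pE x z * H z ≤ H x)
    (hb : ∀ x ∈ D, ∀ z ∉ D, S.adjE x z → F z ≤ H z) : ∀ x ∈ D, F x ≤ H x := by
  have hfin : ∀ {F : S.E → ℝ≥0∞}, (∀ x, F x ≠ ∞) → ∀ x, ∑' z, S.pE x z * F z ≠ ∞ := by
    intro F hF x h
    have hs : (Function.support fun z => S.pE x z * F z).Finite :=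
      (S.ball_finite x 1).subset fun z hz =>
        S.dE_le_one (S.adjE_of_pE_ne_zero (left_ne_zero_of_mul hz))
    rw [tsum_eq_sum (s := hs.toFinset) fun z hz => by
      by_contra h0
      exact hz (hs.mem_toFinset.2 h0)] at h
    obtain ⟨z, -, hz⟩ := ENNReal.sum_eq_top.1 h
    exact ENNReal.mul_ne_top ENNReal.ofReal_ne_top (hF z) hz
  have key := nonneg_of_superharmonic hD (f := fun z => (H z).toReal - (F z).toReal) ?_ ?_
  · intro x hx
    exact (ENNReal.toReal_le_toReal (hF x) (hH x)).1 (sub_nonneg.1 (key x hx))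
  · intro x hx
    simp only [mul_sub]
    rw [(summable_ptrans_mul _ x).tsum_sub (summable_ptrans_mul _ x), ← toReal_tsum_pE hF,
      ← toReal_tsum_pE hH]
    exact sub_le_sub (ENNReal.toReal_mono (hH x) (hsup x hx))
      (ENNReal.toReal_mono (hfin hF x) (hsub x hx))
  · intro x hx z hz hxz
    exact sub_nonneg.2 (ENNReal.toReal_mono (hH z) (hb x hx z hz hxz))

end Comparison

section Chaining

variable {S : GraphSetup} {W : WalkLaw S} {cg cg' : ℝ}

theorem rpow_neg_ν_anti {a b : ℝ} (ha : 0 < a) (hab : a ≤ b) : b ^ (-S.ν) ≤ a ^ (-S.ν) :=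
  Real.rpow_le_rpow_of_nonpos ha hab (neg_nonpos.2 S.ν_pos.le)

theorem green_eq_ofReal (hG : W.GreenBounds cg cg') (x y : S.E) :
    S.greenK ∅ x y = ENNReal.ofReal (W.green x y) :=
  ofReal_green W (lt_of_lt_of_le (mul_pos hG.1 (Real.rpow_pos_of_pos
    (lt_max_of_lt_right one_pos) _)) (hG.2.2 x y).1).ne'

theorem green_ne_top (hG : W.GreenBounds cg cg') (x y : S.E) : S.greenK ∅ x y ≠ ∞ := by
  rw [green_eq_ofReal hG]
  exact ENNReal.ofReal_ne_top

theorem greenK_ne_top (hG : W.GreenBounds cg cg') (K : Set S.E) (x y : S.E) :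
    S.greenK K x y ≠ ∞ :=
  ne_top_of_le_ne_top (green_ne_top hG x y) (S.greenK_le K x y)

theorem le_green (hG : W.GreenBounds cg cg') {x y : S.E} {s : ℝ} (hs : 1 ≤ s)
    (h : S.dE x y ≤ s) : ENNReal.ofReal (cg * s ^ (-S.ν)) ≤ S.greenK ∅ x y := by
  rw [green_eq_ofReal hG]
  refine ENNReal.ofReal_le_ofReal (le_trans ?_ (hG.2.2 x y).1)
  exact mul_le_mul_of_nonneg_left
    (rpow_neg_ν_anti (lt_max_of_lt_right one_pos) (max_le h hs)) hG.1.le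

theorem green_le (hG : W.GreenBounds cg cg') {x y : S.E} {s : ℝ} (hs : 0 < s)
    (h : s ≤ S.dE x y) : S.greenK ∅ x y ≤ ENNReal.ofReal (cg' * s ^ (-S.ν)) := by
  rw [green_eq_ofReal hG]
  refine ENNReal.ofReal_le_ofReal (le_trans (hG.2.2 x y).2 ?_)
  exact mul_le_mul_of_nonneg_left
    (rpow_neg_ν_anti hs (le_max_of_le_left h)) (hG.1.le.trans hG.2.1)

/-- The multiplicative loss in one step of the chaining argument. -/
def chainConst (S : GraphSetup) (cg cg' : ℝ) : ℝ :=
  cg * 2 ^ (-S.ν) / (2 * cg' * 2 ^ S.ν)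

theorem chainConst_pos (hG : W.GreenBounds cg cg') : 0 < chainConst S cg cg' := by
  have := hG.1
  have := hG.1.trans_le hG.2.1
  unfold chainConst
  positivity

theorem chainConst_le_one (hG : W.GreenBounds cg cg') : chainConst S cg cg' ≤ 1 := by
  have h0 := hG.1.trans_le hG.2.1
  have h1 : (1 : ℝ) ≤ 2 ^ S.ν := Real.one_le_rpow one_le_two S.ν_pos.le
  have h2 : (2 : ℝ) ^ (-S.ν) ≤ 1 := Real.rpow_le_one_of_one_le_of_nonpos one_le_two
    (neg_nonpos.2 S.ν_pos.le)
  refine (div_le_one (by positivity)).2 ?_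
  calc cg * 2 ^ (-S.ν) ≤ cg' * 1 := mul_le_mul hG.2.1 h2 (by positivity) h0.le
    _ ≤ 2 * cg' * 2 ^ S.ν := by nlinarith

/-- A nonnegative superharmonic function bounded below on a ball is comparably bounded below on
the doubled ball. -/
theorem superharmonic_doubling (hG : W.GreenBounds cg cg') {M s : ℝ} (hM : 2 ≤ M)
    (hM' : cg' * M ^ (-S.ν) ≤ cg * 2 ^ (-S.ν) / 2) (hs : 2 ≤ s) {K : Set S.E}
    {φ : S.E → ℝ≥0∞} (hφ : ∀ x, φ x ≠ ∞) (hsup : ∀ x ∉ K, ∑' z, S.pE x z * φ z ≤ φ x)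
    {p : S.E} (hp : ∀ k ∈ K, M * s < S.dE p k) {a : ℝ} (ha : 0 < a)
    (h : ∀ w ∈ S.ball p s, ENNReal.ofReal a ≤ φ w) :
    ∀ w ∈ S.ball p (2 * s), ENNReal.ofReal (chainConst S cg cg' * a) ≤ φ w := by
  intro w hw
  have hw : S.dE p w ≤ 2 * s := hw
  by_cases hws : w ∈ S.ball p s
  · refine le_trans (ENNReal.ofReal_le_ofReal ?_) (h w hws)
    exact mul_le_of_le_one_left ha.le (chainConst_le_one hG)
  have hcg := hG.1
  have hcg' := hG.1.trans_le hG.2.1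
  have hs0 : 0 < s := by linarith
  have hσ : 0 < s ^ (-S.ν) := Real.rpow_pos_of_pos hs0 _
  have h2 : (0 : ℝ) < 2 ^ (-S.ν) := Real.rpow_pos_of_pos two_pos _
  have h2' : (2 : ℝ) ^ S.ν = (2 ^ (-S.ν))⁻¹ := by rw [Real.rpow_neg two_pos.le, inv_inv]
  have hhalf : (s / 2) ^ (-S.ν) = s ^ (-S.ν) * 2 ^ S.ν := by
    rw [Real.div_rpow hs0.le two_pos.le, Real.rpow_neg two_pos.le, div_inv_eq_mul]
  set A : ℝ := a / (cg' * (s / 2) ^ (-S.ν)) with hA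
  have hA0 : 0 < A := div_pos ha (mul_pos hcg' (Real.rpow_pos_of_pos (by linarith) _))
  set D : Set S.E := S.ball p (M * s) \ S.ball p s with hD
  have key := le_of_subharmonic_of_superharmonic (D := D)
    ((S.ball_finite p (M * s)).subset Set.sdiff_subset)
    (F := fun w => ENNReal.ofReal A * S.greenK ∅ w p)
    (H := fun w => φ w + ENNReal.ofReal (A * (cg' * (M * s) ^ (-S.ν))))
    (fun x => ENNReal.mul_ne_top ENNReal.ofReal_ne_top (green_ne_top hG x p))
    (fun x => ENNReal.add_ne_top.2 ⟨hφ x, ENNReal.ofReal_ne_top⟩) ?_ ?_ ?_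
  · have hwD : w ∈ D := ⟨show S.dE p w ≤ M * s by nlinarith, hws⟩
    have h1 := key w hwD
    have h3 := le_green hG (x := w) (y := p) (s := 2 * s) (by linarith) (by rwa [S.dE_comm])
    have h4 : ENNReal.ofReal (A * (cg * (2 * s) ^ (-S.ν))) ≤
        φ w + ENNReal.ofReal (A * (cg' * (M * s) ^ (-S.ν))) := by
      rw [ENNReal.ofReal_mul hA0.le]
      exact le_trans (by gcongr) h1
    rw [← tsub_le_iff_right, ← ENNReal.ofReal_sub _ (by positivity)] at h4
    refine le_trans (ENNReal.ofReal_le_ofReal ?_) h4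
    rw [Real.mul_rpow (by linarith) hs0.le, Real.mul_rpow (by linarith) hs0.le, chainConst]
    have h5 : A * (cg * (2 ^ (-S.ν) * s ^ (-S.ν))) - A * (cg' * (M ^ (-S.ν) * s ^ (-S.ν))) =
        A * s ^ (-S.ν) * (cg * 2 ^ (-S.ν) - cg' * M ^ (-S.ν)) := by ring
    rw [h5]
    have h6 : cg * 2 ^ (-S.ν) / (2 * cg' * 2 ^ S.ν) * a =
        A * s ^ (-S.ν) * (cg * 2 ^ (-S.ν) / 2) := by
      rw [hA, hhalf]
      field_simp
    rw [h6]
    exact mul_le_mul_of_nonneg_left (by linarith) (by positivity)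
  · intro x hx
    have hxp : x ≠ p := by
      rintro rfl
      exact hx.2 (show S.dE x x ≤ s by rw [S.dE_self]; exact hs0.le)
    simp only [mul_left_comm (S.pE _ _), ENNReal.tsum_mul_left,
      S.tsum_pE_greenK ∅ (Set.notMem_empty x) hxp, le_refl]
  · intro x hx
    simp only [mul_add, ENNReal.tsum_add, ENNReal.tsum_mul_right, S.tsum_pE, one_mul]
    gcongr
    exact hsup x fun hxK => absurd hx.1 (not_le.2 (hp x hxK))
  · intro x hx z hz hxz
    by_cases hzs : z ∈ S.ball p s
    · have hxs : s < S.dE p x := not_le.1 hx.2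
      have := S.dE_triangle p z x
      have := S.dE_le_one hxz
      rw [S.dE_comm x z] at this
      have hg := green_le hG (x := z) (y := p) (s := s / 2) (by linarith)
        (by rw [S.dE_comm]; linarith)
      calc _ ≤ ENNReal.ofReal A * ENNReal.ofReal (cg' * (s / 2) ^ (-S.ν)) := by gcongr
        _ = ENNReal.ofReal a := by
          rw [← ENNReal.ofReal_mul hA0.le, hA, div_mul_cancel₀]
          exact (mul_pos hcg' (Real.rpow_pos_of_pos (by linarith) _)).ne'
        _ ≤ _ := (h z hzs).trans le_self_add
    · have hzM : M * s < S.dE p z := not_le.1 fun h => hz ⟨h, hzs⟩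
      have hg := green_le hG (x := z) (y := p) (s := M * s) (by positivity)
        (by rw [S.dE_comm]; exact hzM.le)
      calc _ ≤ ENNReal.ofReal A * ENNReal.ofReal (cg' * (M * s) ^ (-S.ν)) := by gcongr
        _ = _ := (ENNReal.ofReal_mul hA0.le).symm
        _ ≤ _ := le_add_self

variable (S) in
/-- `q` is reached from `p` by a chain of `n` steps of size at most `s` inside `A`. -/
def Reach (A : Set S.E) (s : ℝ) : ℕ → S.E → S.E → Prop
  | 0, p, q => p = q
  | n + 1, p, q => ∃ p', (p ∈ A ∧ p' ∈ A ∧ S.dE p p' ≤ s) ∧ Reach A s n p' q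

theorem Reach.trans {A : Set S.E} {s : ℝ} {m n : ℕ} {p q r : S.E} (h : S.Reach A s m p q)
    (h' : S.Reach A s n q r) : S.Reach A s (m + n) p r := by
  induction m generalizing p with
  | zero =>
    obtain rfl : p = q := h
    rwa [Nat.zero_add]
  | succ m ih =>
    obtain ⟨p', h1, h2⟩ := h
    rw [Nat.succ_add]
    exact ⟨p', h1, ih h2⟩

theorem Reach.symm {A : Set S.E} {s : ℝ} {n : ℕ} {p q : S.E} (h : S.Reach A s n p q) :
    S.Reach A s n q p := by
  induction n generalizing p with
  | zero => exact Eq.symm h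
  | succ n ih =>
    obtain ⟨p', ⟨h1, h1', h1''⟩, h2⟩ := h
    exact (ih h2).trans (n := 1) ⟨p, ⟨h1', h1, by rwa [S.dE_comm]⟩, rfl⟩

theorem Reach.superharmonic (hG : W.GreenBounds cg cg') {M s : ℝ} (hM : 2 ≤ M)
    (hM' : cg' * M ^ (-S.ν) ≤ cg * 2 ^ (-S.ν) / 2) (hs : 2 ≤ s) {K A : Set S.E}
    {φ : S.E → ℝ≥0∞} (hφ : ∀ x, φ x ≠ ∞) (hsup : ∀ x ∉ K, ∑' z, S.pE x z * φ z ≤ φ x)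
    (hA : ∀ p ∈ A, ∀ k ∈ K, M * s < S.dE p k) {n : ℕ} {p q : S.E} (hr : S.Reach A s n p q)
    {a : ℝ} (ha : 0 < a) (h : ∀ w ∈ S.ball p s, ENNReal.ofReal a ≤ φ w) :
    ∀ w ∈ S.ball q s, ENNReal.ofReal (chainConst S cg cg' ^ n * a) ≤ φ w := by
  induction n generalizing p a with
  | zero =>
    obtain rfl : p = q := hr
    simpa using h
  | succ n ih =>
    obtain ⟨p', ⟨h1, h1', h1''⟩, h2⟩ := hr
    rw [pow_succ, mul_assoc]
    refine ih h2 (mul_pos (chainConst_pos hG) ha) fun w hw => ?_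
    refine superharmonic_doubling hG hM hM' hs hφ hsup (hA p h1) ha h w ?_
    have := S.dE_triangle p p' w
    have hw : S.dE p' w ≤ s := hw
    exact show S.dE p w ≤ 2 * s by linarith

theorem reach_horizontal {A : Set S.E} {s : ℝ} {m : ℕ} (hm : (m : ℝ) ≤ s) {z : ℤ}
    (hA : ∀ v, (v, z) ∈ A) (n : ℕ) (v v' : S.V) (h : S.dG v v' ≤ n * m) :
    S.Reach A s n (v, z) (v', z) := by
  induction n generalizing v with
  | zero =>
    rw [Nat.zero_mul] at h
    obtain ⟨p, h0, hn, -⟩ := (S.dG_spec v v' 0).1 h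
    rw [← h0, ← hn]
    exact rfl
  | succ n ih =>
    rw [Nat.succ_mul, Nat.add_comm] at h
    obtain ⟨u, h1, h2⟩ := S.exists_dG_split h
    refine ⟨(u, z), ⟨hA v, hA u, ?_⟩, ih u h2⟩
    refine max_le (le_trans (Nat.cast_le.2 h1) hm) ?_
    simpa [Real.zero_rpow S.two_div_β_pos.ne'] using le_trans (Nat.cast_nonneg m) hm

theorem reach_vertical {A : Set S.E} {s : ℝ} {m : ℕ} (hs : 0 ≤ s)
    (hm : (m : ℝ) ≤ s ^ (S.β / 2)) {v : S.V} (n : ℕ) (z z' : ℤ)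
    (hA : ∀ z'' ∈ Set.uIcc z z', (v, z'') ∈ A) (h : (z - z').natAbs ≤ n * m) :
    S.Reach A s n (v, z) (v, z') := by
  induction n generalizing z with
  | zero =>
    have : z = z' := by omega
    rw [this]
    exact rfl
  | succ n ih =>
    obtain ⟨u, hu, h1, h2⟩ : ∃ u ∈ Set.uIcc z z', (z - u).natAbs ≤ m ∧ (u - z').natAbs ≤ n * m := by
      simp only [Set.mem_uIcc]
      rw [Nat.succ_mul] at h
      generalize n * m = k at h
      rcases le_total z z' with hz | hz
      · exact ⟨min (z + m) z', by omega, by omega, by omega⟩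
      · exact ⟨max (z - m) z', by omega, by omega, by omega⟩
    refine ⟨(v, u), ⟨hA z Set.left_mem_uIcc, hA u hu, ?_⟩,
      ih u (fun x hx => hA x (Set.uIcc_subset_uIcc hu Set.right_mem_uIcc hx)) h2⟩
    refine max_le (by simpa [S.dG_self] using hs)
      ((S.rpow_two_div_β_le (abs_nonneg _) hs).2 (le_trans ?_ hm))
    have : |z - u| ≤ m := by rw [Int.abs_eq_natAbs]; exact_mod_cast h1
    exact_mod_cast this

end Chaining

section Geometry

variable {S : GraphSetup}

/-- One-dimensional core of the routing argument: two obstacles `[zᵢ - h, zᵢ + h]`, each of which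
may be absent, can be left by a monotone motion. -/
theorem exists_level {A₁ A₂ : Prop} {z z₁ z₂ : ℤ} {h V : ℕ} (hV : h < V)
    (h₁ : A₁ ∨ h < (z - z₁).natAbs) (h₂ : A₂ ∨ h < (z - z₂).natAbs)
    (hz : (z - z₁).natAbs ≤ V) (hz' : (z₁ - z₂).natAbs ≤ V) :
    ∃ z', (z' - z₁).natAbs ≤ 2 * V ∧ h < (z' - z₁).natAbs ∧ h < (z' - z₂).natAbs ∧
      ∀ z'' ∈ Set.uIcc z z', (A₁ ∨ h < (z'' - z₁).natAbs) ∧ (A₂ ∨ h < (z'' - z₂).natAbs) := by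
  simp only [Set.mem_uIcc]
  by_cases hA₁ : A₁ <;> by_cases hA₂ : A₂ <;>
    simp only [hA₁, hA₂, true_or, false_or, true_and, and_true, implies_true] at h₁ h₂ ⊢
  · exact ⟨max z₁ z₂ + V, by omega, by omega, by omega⟩
  · rcases le_total z z₂ with h | h
    · exact ⟨min z₁ z₂ - V, by omega, by omega, by omega, fun _ _ => by omega⟩
    · exact ⟨max z₁ z₂ + V, by omega, by omega, by omega, fun _ _ => by omega⟩
  · rcases le_total z z₁ with h | h
    · exact ⟨min z₁ z₂ - V, by omega, by omega, by omega, fun _ _ => by omega⟩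
    · exact ⟨max z₁ z₂ + V, by omega, by omega, by omega, fun _ _ => by omega⟩
  · exact ⟨z, by omega, by omega, by omega, fun _ _ => by omega⟩

theorem lt_dE_iff {a : ℝ} (ha : 0 ≤ a) (x y : S.E) :
    a < S.dE x y ↔ a < S.dG y.1 x.1 ∨ ⌊a ^ (S.β / 2)⌋₊ < (y.2 - x.2).natAbs := by
  rw [dE, lt_max_iff, S.dG_comm x.1, abs_sub_comm]
  refine or_congr Iff.rfl ?_
  rw [← not_le, S.rpow_two_div_β_le (abs_nonneg _) ha, not_le,
    Nat.floor_lt (Real.rpow_nonneg ha _), Nat.cast_natAbs]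
  push_cast
  rfl

/-- Points outside two balls can be joined to a common far away hub, by a chain of bounded length
staying outside both balls. -/
theorem exists_hub (S : GraphSetup) {M Λ : ℝ} (hM : 2 ≤ M) (hΛ : 100000 ≤ Λ) :
    ∃ N : ℕ, ∀ (t : ℝ) (x₁ x₂ : S.E), 2 * M ≤ t → S.dE x₁ x₂ ≤ 80000 * t →
      ∃ o, Λ * t < S.dE x₁ o ∧ Λ * t < S.dE x₂ o ∧
        ∀ y, 3 * t < S.dE x₁ y → 3 * t < S.dE x₂ y → S.dE x₁ y ≤ 100000 * t →
          S.Reach {p | 3 * t < S.dE x₁ p ∧ 3 * t < S.dE x₂ p} (t / M) N y o := by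
  refine ⟨⌈24 * (Λ * M) ^ (S.β / 2)⌉₊ + (⌈600000 * M⌉₊ + ⌈24 * (Λ * M) ^ (S.β / 2)⌉₊),
    fun t x₁ x₂ ht hx => ?_⟩
  have hβ : 1 ≤ S.β / 2 := by linarith [S.β_ge_two]
  have hM0 : 0 < M := by linarith
  have ht0 : 4 ≤ t := by linarith
  have htM : 2 ≤ t / M := (le_div_iff₀ hM0).2 ht
  set s := t / M with hs
  have hts : t = M * s := by rw [hs]; field_simp
  have hΛt : 1 ≤ Λ * t := by nlinarith
  have mono : ∀ {a b : ℝ}, 0 ≤ a → a ≤ b → a ^ (S.β / 2) ≤ b ^ (S.β / 2) := fun h h' =>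
    Real.rpow_le_rpow h h' (by linarith)
  set V : ℕ := ⌊(Λ * t) ^ (S.β / 2)⌋₊ + 1 with hV
  set h : ℕ := ⌊(3 * t) ^ (S.β / 2)⌋₊ with hh
  have hhV : h < V := Nat.lt_succ_of_le (Nat.floor_le_floor (mono (by linarith) (by nlinarith)))
  have hvert : ∀ {x y : S.E} {a : ℝ}, 0 ≤ a → a ≤ Λ * t → S.dE x y ≤ a →
      (y.2 - x.2).natAbs ≤ V := by
    intro x y a ha haΛ hd
    have h1 := not_or.1 (mt (S.lt_dE_iff ha x y).2 (not_lt.2 hd))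
    have h2 := Nat.floor_le_floor (mono ha haΛ)
    omega
  have hVΛ : (V : ℝ) ≤ 2 * (Λ * t) ^ (S.β / 2) := by
    have h1 := Nat.floor_le (Real.rpow_nonneg (zero_le_one.trans hΛt) (S.β / 2))
    have h2 : 1 ≤ (Λ * t) ^ (S.β / 2) := Real.one_le_rpow hΛt (by linarith)
    rw [hV]
    push_cast
    linarith
  have half : ∀ {a : ℝ}, 2 ≤ a → a / 2 ≤ ⌊a⌋₊ := fun {a} ha => by
    linarith [Nat.lt_floor_add_one a]
  have hmh : s / 2 ≤ ⌊s⌋₊ := half htM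
  have hsβ : 2 ≤ s ^ (S.β / 2) := htM.trans (Real.self_le_rpow_of_one_le (by linarith) hβ)
  have hmv : s ^ (S.β / 2) / 2 ≤ ⌊s ^ (S.β / 2)⌋₊ := half hsβ
  have hnv : 4 * V ≤ ⌈24 * (Λ * M) ^ (S.β / 2)⌉₊ * ⌊s ^ (S.β / 2)⌋₊ := by
    have h1 := Nat.le_ceil (24 * (Λ * M) ^ (S.β / 2))
    have h2 : (Λ * t) ^ (S.β / 2) = (Λ * M) ^ (S.β / 2) * s ^ (S.β / 2) := by
      rw [← Real.mul_rpow (by positivity) (by linarith), hts, mul_assoc]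
    have h3 := mul_le_mul h1 hmv (by linarith) (Nat.cast_nonneg _)
    have h4 : 0 ≤ (Λ * M) ^ (S.β / 2) * s ^ (S.β / 2) := by positivity
    have : (4 * V : ℝ) ≤ ⌈24 * (Λ * M) ^ (S.β / 2)⌉₊ * ⌊s ^ (S.β / 2)⌋₊ := by nlinarith
    exact_mod_cast this
  have hnh : 300000 * t ≤ ⌈600000 * M⌉₊ * ⌊s⌋₊ := by
    have h1 := Nat.le_ceil (600000 * M)
    have h3 := mul_le_mul h1 hmh (by linarith) (Nat.cast_nonneg _)
    nlinarith
  obtain ⟨u, hu⟩ := S.exists_dG_eq x₁.1 ⌈100000 * t⌉₊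
  have hu₁ : 100000 * t ≤ S.dG x₁.1 u := hu ▸ Nat.le_ceil _
  have hu₁' : S.dG x₁.1 u ≤ 100000 * t + 1 := by
    rw [hu]
    exact (Nat.ceil_lt_add_one (by linarith)).le
  have hx12 : (S.dG x₁.1 x₂.1 : ℝ) ≤ 80000 * t := le_trans (le_max_left _ _) hx
  have hu₂ : 20000 * t ≤ S.dG x₂.1 u := by
    have h1 : (S.dG x₁.1 u : ℝ) ≤ S.dG x₁.1 x₂.1 + S.dG x₂.1 u := by
      exact_mod_cast S.dG_triangle _ _ _
    linarith
  have hzz : (x₁.2 - x₂.2).natAbs ≤ V := by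
    have := hvert (a := 80000 * t) (by linarith) (by nlinarith) hx
    omega
  set zp : ℤ := max x₁.2 x₂.2 + V with hzp
  have hgood : ∀ p : S.E, p ∈ {p | 3 * t < S.dE x₁ p ∧ 3 * t < S.dE x₂ p} ↔
      (3 * t < S.dG p.1 x₁.1 ∨ h < (p.2 - x₁.2).natAbs) ∧
      (3 * t < S.dG p.1 x₂.1 ∨ h < (p.2 - x₂.2).natAbs) := fun p =>
    and_congr (S.lt_dE_iff (by linarith) _ _) (S.lt_dE_iff (by linarith) _ _)
  refine ⟨(u, zp), ?_, ?_, fun y hy₁ hy₂ hy => ?_⟩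
  · exact (S.lt_dE_iff (by linarith) _ _).2 (Or.inr (by simp only; omega))
  · exact (S.lt_dE_iff (by linarith) _ _).2 (Or.inr (by simp only; omega))
  have hyV : (y.2 - x₁.2).natAbs ≤ V := hvert (a := 100000 * t) (by linarith) (by nlinarith) hy
  obtain ⟨hg₁, hg₂⟩ := (hgood y).1 ⟨hy₁, hy₂⟩
  obtain ⟨z', hz', hz₁, hz₂, hpath⟩ := exists_level hhV hg₁ hg₂ hyV hzz
  have leg₁ : S.Reach {p | 3 * t < S.dE x₁ p ∧ 3 * t < S.dE x₂ p} s
      ⌈24 * (Λ * M) ^ (S.β / 2)⌉₊ (y.1, y.2) (y.1, z') :=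
    reach_vertical (by linarith) (Nat.floor_le (by linarith)) _ _ _
      (fun z'' hz'' => (hgood _).2 (hpath z'' hz'')) (le_trans (by omega) hnv)
  have leg₂ : S.Reach {p | 3 * t < S.dE x₁ p ∧ 3 * t < S.dE x₂ p} s ⌈600000 * M⌉₊
      (y.1, z') (u, z') := by
    refine reach_horizontal (Nat.floor_le (by linarith))
      (fun v => (hgood _).2 ⟨Or.inr hz₁, Or.inr hz₂⟩) _ _ _ ?_
    have h1 : (S.dG y.1 u : ℝ) ≤ S.dG y.1 x₁.1 + S.dG x₁.1 u := by
      exact_mod_cast S.dG_triangle _ _ _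
    have h2 : (S.dG y.1 x₁.1 : ℝ) ≤ 100000 * t := by
      rw [S.dG_comm]
      exact le_trans (le_max_left _ _) hy
    have h3 : (S.dG y.1 u : ℝ) ≤ ⌈600000 * M⌉₊ * ⌊s⌋₊ := by linarith
    exact_mod_cast h3
  have leg₃ : S.Reach {p | 3 * t < S.dE x₁ p ∧ 3 * t < S.dE x₂ p} s
      ⌈24 * (Λ * M) ^ (S.β / 2)⌉₊ (u, z') (u, zp) := by
    refine reach_vertical (by linarith) (Nat.floor_le (by linarith)) _ _ _
      (fun z'' _ => (hgood _).2 ⟨Or.inl ?_, Or.inl ?_⟩) (le_trans (by omega) hnv)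
    · rw [S.dG_comm]
      exact lt_of_lt_of_le (by linarith) hu₁
    · rw [S.dG_comm]
      exact lt_of_lt_of_le (by linarith) hu₂
  exact leg₁.trans (leg₂.trans leg₃)

end Geometry

section Core

variable {S : GraphSetup} {W : WalkLaw S} {cg cg' : ℝ}

/-- The walk started far away from two balls is likely to avoid any subset of them. -/
theorem half_le_escE (hG : W.GreenBounds cg cg') {a t : ℝ} (ha : 0 < a)
    (ha' : cg' * a ^ (-S.ν) ≤ cg * 2 ^ (-S.ν) / 4) (ht : 1 ≤ t) {x₁ x₂ w : S.E} {K : Set S.E}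
    (hK : K ⊆ S.ball x₁ (2 * t) ∪ S.ball x₂ (2 * t)) (h₁ : a * t ≤ S.dE x₁ w)
    (h₂ : a * t ≤ S.dE x₂ w) : ENNReal.ofReal (1 / 2) ≤ escE W K w := by
  have hcg := hG.1
  have ht0 : 0 < t := by linarith
  have hτ : 0 < t ^ (-S.ν) := Real.rpow_pos_of_pos ht0 _
  set b := ENNReal.ofReal (cg * (2 * t) ^ (-S.ν)) with hb
  have hb0 : 0 < cg * (2 * t) ^ (-S.ν) :=
    mul_pos hcg (Real.rpow_pos_of_pos (by positivity) _)
  have hb0' : b ≠ 0 := (ENNReal.ofReal_pos.2 hb0).ne'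
  have hle : ∀ {i k}, k ∈ S.ball i (2 * t) → b ≤ S.greenK ∅ k i := fun h =>
    le_green hG (by linarith) (by rw [S.dE_comm]; exact h)
  have hfar : ∀ {i}, a * t ≤ S.dE i w → S.greenK ∅ w i ≤ ENNReal.ofReal (1 / 4) * b := by
    intro i hi
    refine (green_le hG (mul_pos ha ht0) (by rwa [S.dE_comm])).trans ?_
    rw [hb, ← ENNReal.ofReal_mul (by norm_num)]
    refine ENNReal.ofReal_le_ofReal ?_
    rw [Real.mul_rpow ha.le ht0.le, Real.mul_rpow two_pos.le ht0.le]
    nlinarith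
  have key := one_le_escE_add W K
    (v := fun w => (S.greenK ∅ w x₁ + S.greenK ∅ w x₂) * b⁻¹) ?_ ?_ w
  · have hv : (S.greenK ∅ w x₁ + S.greenK ∅ w x₂) * b⁻¹ ≤ ENNReal.ofReal (1 / 2) := by
      rw [← div_eq_mul_inv]
      refine ENNReal.div_le_of_le_mul ((add_le_add (hfar h₁) (hfar h₂)).trans_eq ?_)
      rw [← add_mul, ← ENNReal.ofReal_add (by norm_num) (by norm_num)]
      norm_num
    have h1 := key.trans (add_le_add_right hv _)
    rw [← tsub_le_iff_right, ← ENNReal.ofReal_one, ← ENNReal.ofReal_sub _ (by norm_num)] at h1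
    refine le_trans (ENNReal.ofReal_le_ofReal (by norm_num)) h1
  · intro k hk
    rw [← div_eq_mul_inv, ENNReal.le_div_iff_mul_le (Or.inl hb0') (Or.inl ENNReal.ofReal_ne_top),
      one_mul]
    rcases hK hk with h | h
    · exact (hle h).trans le_self_add
    · exact (hle h).trans le_add_self
  · intro x _
    simp only [← mul_assoc, mul_add, ENNReal.tsum_mul_right, ENNReal.tsum_add]
    gcongr <;> exact S.tsum_pE_greenK_le ∅ (Set.notMem_empty x) _

/-- Just outside the two balls containing `K`, the Green density killed on `K` is bounded below
by the order of the Green density. -/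
theorem le_greenK_near (hG : W.GreenBounds cg cg') {M s : ℝ} (hM : 2 ≤ M)
    (hM' : cg' * M ^ (-S.ν) ≤ cg * 2 ^ (-S.ν) / 2) (hs : 2 ≤ s) {K : Set S.E} {x : S.E}
    (hx : ∀ k ∈ K, M * s < S.dE x k) :
    ∀ w ∈ S.ball x s, ENNReal.ofReal (cg * (M * s) ^ (-S.ν) / 2) ≤ S.greenK K w x := by
  intro w hw
  have hcg := hG.1
  have hcg' := hG.1.trans_le hG.2.1
  have hσ : 0 < s ^ (-S.ν) := Real.rpow_pos_of_pos (by linarith) _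
  have hM1 : M ^ (-S.ν) ≤ 1 := Real.rpow_le_one_of_one_le_of_nonpos (by linarith)
    (neg_nonpos.2 S.ν_pos.le)
  have h2 : (2 : ℝ) ^ (-S.ν) ≤ 1 := Real.rpow_le_one_of_one_le_of_nonpos one_le_two
    (neg_nonpos.2 S.ν_pos.le)
  have h1 := (le_green hG (x := w) (y := x) (s := s) (by linarith)
    (by rw [S.dE_comm]; exact hw)).trans (S.green_le_greenK_add K (fun k hk =>
      green_le hG (s := M * s) (by positivity) (by rw [S.dE_comm]; exact (hx k hk).le)) w)
  have hm : (M * s) ^ (-S.ν) = M ^ (-S.ν) * s ^ (-S.ν) :=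
    Real.mul_rpow (by linarith) (by linarith)
  rw [← tsub_le_iff_right, ← ENNReal.ofReal_sub _ (by positivity)] at h1
  refine le_trans (ENNReal.ofReal_le_ofReal ?_) h1
  rw [hm]
  have h3 : cg * M ^ (-S.ν) ≤ cg := mul_le_of_le_one_right hcg.le hM1
  have h4 : cg * 2 ^ (-S.ν) ≤ cg := mul_le_of_le_one_right hcg.le h2
  nlinarith

theorem exists_two_le_mul_rpow_neg_le (S : GraphSetup) (b : ℝ) {ε : ℝ} (hε : 0 < ε) :
    ∃ M : ℝ, 2 ≤ M ∧ b * M ^ (-S.ν) ≤ ε := by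
  have h := (tendsto_rpow_neg_atTop S.ν_pos).const_mul b
  rw [mul_zero] at h
  exact ((eventually_ge_atTop 2).and (h.eventually_le_const hε)).exists

/-- Inside two balls containing `K`, the killed Green density with pole near their boundary is
comparable to the escape probability. -/
theorem greenK_comparable_escE (hG : W.GreenBounds cg cg') :
    ∃ t₀ c C : ℝ, 4 ≤ t₀ ∧ 0 < c ∧ 0 < C ∧ ∀ (t : ℝ) (x₁ x₂ x : S.E) (K : Set S.E), t₀ ≤ t →
      S.dE x₁ x₂ ≤ 80000 * t → K ⊆ S.ball x₁ (2 * t) ∪ S.ball x₂ (2 * t) →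
      4 * t - 1 < S.dE x₁ x → 4 * t - 1 < S.dE x₂ x →
      (S.dE x₁ x ≤ 4 * t + 1 ∨ S.dE x₂ x ≤ 4 * t + 1) →
      ∀ w ∈ S.ball x₁ (3 * t) ∪ S.ball x₂ (3 * t),
        ENNReal.ofReal (c * t ^ (-S.ν)) * escE W K w ≤ S.greenK K w x ∧
          S.greenK K w x ≤ ENNReal.ofReal (C * t ^ (-S.ν)) * escE W K w := by
  have hcg := hG.1
  have hcg' := hG.1.trans_le hG.2.1
  have h2ν : (0 : ℝ) < 2 ^ (-S.ν) := Real.rpow_pos_of_pos two_pos _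
  obtain ⟨M, hM, hM'⟩ := S.exists_two_le_mul_rpow_neg_le cg' (ε := cg * 2 ^ (-S.ν) / 2)
    (by positivity)
  obtain ⟨a, ha, ha'⟩ := S.exists_two_le_mul_rpow_neg_le cg' (ε := cg * 2 ^ (-S.ν) / 4)
    (by positivity)
  obtain ⟨N, hN⟩ := S.exists_hub (Λ := a + 100000) hM (by linarith)
  set κ := chainConst S cg cg' with hκ
  have hκ0 : 0 < κ := chainConst_pos hG
  refine ⟨2 * M, κ ^ N * (κ ^ N * (cg / 2)), cg' * 2 ^ S.ν * 2 / κ ^ N, by linarith,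
    by positivity, by positivity, fun t x₁ x₂ x K ht h12 hK hx₁ hx₂ hx => ?_⟩
  have hM0 : 0 < M := by linarith
  have ht4 : 4 ≤ t := by linarith
  obtain ⟨o, ho₁, ho₂, hreach⟩ := hN t x₁ x₂ ht h12
  have hs : 2 ≤ t / M := (le_div_iff₀ hM0).2 ht
  have hMs : M * (t / M) = t := mul_div_cancel₀ t hM0.ne'
  have hst : t / M ≤ t := div_le_self (by linarith) (by linarith)
  set s := t / M
  set A : Set S.E := {p | 3 * t < S.dE x₁ p ∧ 3 * t < S.dE x₂ p}
  have hτ : 0 < t ^ (-S.ν) := Real.rpow_pos_of_pos (by linarith) _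
  have hA : ∀ p ∈ A, ∀ k ∈ K, M * s < S.dE p k := by
    rintro p ⟨hp₁, hp₂⟩ k hk
    rw [hMs, S.dE_comm]
    rcases hK hk with h | h
    · have h : S.dE x₁ k ≤ 2 * t := h
      linarith [S.dE_triangle x₁ k p]
    · have h : S.dE x₂ k ≤ 2 * t := h
      linarith [S.dE_triangle x₂ k p]
  have hself : ∀ y, y ∈ S.ball y s := fun y => show S.dE y y ≤ s by
    rw [S.dE_self]
    linarith
  have hesc_top : ∀ y, escE W K y ≠ ∞ := fun y =>
    ne_top_of_le_ne_top ENNReal.one_ne_top (escE_le_one W K y)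
  have hesc : ∀ y ∈ A, S.dE x₁ y ≤ 100000 * t → ENNReal.ofReal (κ ^ N * (1 / 2)) ≤ escE W K y := by
    intro y hy hy'
    refine (hreach y hy.1 hy.2 hy').symm.superharmonic hG hM hM' hs hesc_top
      (fun x hx => (escE_step W K hx).le) hA (by norm_num) (fun w hw => ?_) y (hself y)
    have hw : S.dE o w ≤ s := hw
    rw [S.dE_comm] at hw
    exact half_le_escE hG (by linarith) ha' (by linarith) hK
      (by linarith [S.dE_triangle x₁ w o]) (by linarith [S.dE_triangle x₂ w o])
  have hxA : x ∈ A := ⟨by linarith, by linarith⟩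
  have hx' : S.dE x₁ x ≤ 100000 * t := by
    rcases hx with h | h <;> linarith [S.dE_triangle x₁ x₂ x]
  have hgreen : ∀ y ∈ A, S.dE x₁ y ≤ 100000 * t →
      ENNReal.ofReal (κ ^ N * (κ ^ N * (cg / 2)) * t ^ (-S.ν)) ≤ S.greenK K y x := by
    intro y hy hy'
    have hsup : ∀ z ∉ K, ∑' w, S.pE z w * S.greenK K w x ≤ S.greenK K z x := fun z hz =>
      S.tsum_pE_greenK_le K hz x
    have h0 := le_greenK_near hG hM hM' hs (hA x hxA)
    rw [hMs] at h0
    have h1 := (hreach x hxA.1 hxA.2 hx').superharmonic hG hM hM' hs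
      (fun w => greenK_ne_top hG K w x) hsup hA (by positivity) h0
    have h2 := (hreach y hy.1 hy.2 hy').symm.superharmonic hG hM hM' hs
      (fun w => greenK_ne_top hG K w x) hsup hA (by positivity) h1 y (hself y)
    refine le_trans (ENNReal.ofReal_le_ofReal (le_of_eq ?_)) h2
    ring
  set B : Set S.E := S.ball x₁ (3 * t) ∪ S.ball x₂ (3 * t)
  have hBA : ∀ z ∉ B, z ∈ A := fun z hz =>
    ⟨not_le.1 fun h => hz (Or.inl h), not_le.1 fun h => hz (Or.inr h)⟩
  have hxB : x ∉ B := fun h => h.elim (not_le.2 hxA.1) (not_le.2 hxA.2)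
  have hD : (B \ K).Finite :=
    ((S.ball_finite _ _).union (S.ball_finite _ _)).subset Set.sdiff_subset
  have hnear : ∀ w ∈ B \ K, ∀ z, S.adjE w z →
      S.dE x₁ z ≤ 100000 * t ∧ t / 2 ≤ S.dE z x := by
    rintro w ⟨hw, -⟩ z hz
    have hz := S.dE_le_one hz
    rcases hw with hw | hw
    · have hw : S.dE x₁ w ≤ 3 * t := hw
      have := S.dE_triangle x₁ w z
      exact ⟨by linarith, by linarith [S.dE_triangle x₁ z x]⟩
    · have hw : S.dE x₂ w ≤ 3 * t := hw
      have := S.dE_triangle x₂ w z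
      exact ⟨by linarith [S.dE_triangle x₁ x₂ z], by linarith [S.dE_triangle x₂ z x]⟩
  have hharm : ∀ w ∈ B \ K, ∑' z, S.pE w z * S.greenK K z x = S.greenK K w x := fun w hw =>
    S.tsum_pE_greenK K hw.2 fun h => hxB (h ▸ hw.1)
  have hesc_mul : ∀ (b : ℝ≥0∞), ∀ w ∈ B \ K,
      ∑' z, S.pE w z * (b * escE W K z) = b * escE W K w := fun b w hw => by
    simp only [mul_left_comm (S.pE _ _), ENNReal.tsum_mul_left, escE_step W K hw.2]
  intro w hw
  by_cases hwK : w ∈ K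
  · simp [S.greenK_of_mem K hwK, escE_of_mem W K hwK]
  constructor
  · refine le_of_subharmonic_of_superharmonic hD
      (F := fun w => ENNReal.ofReal (κ ^ N * (κ ^ N * (cg / 2)) * t ^ (-S.ν)) * escE W K w)
      (H := fun w => S.greenK K w x)
      (fun y => ENNReal.mul_ne_top ENNReal.ofReal_ne_top (hesc_top y))
      (fun y => greenK_ne_top hG K y x) (fun y hy => (hesc_mul _ y hy).ge)
      (fun y hy => (hharm y hy).le) (fun y hy z hz hyz => ?_) w ⟨hw, hwK⟩
    by_cases hzK : z ∈ K
    · simp [escE_of_mem W K hzK]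
    · exact (mul_le_of_le_one_right' (escE_le_one W K z)).trans
        (hgreen z (hBA z fun h => hz ⟨h, hzK⟩) (hnear y hy z hyz).1)
  · refine le_of_subharmonic_of_superharmonic hD
      (F := fun w => S.greenK K w x)
      (H := fun w => ENNReal.ofReal (cg' * 2 ^ S.ν * 2 / κ ^ N * t ^ (-S.ν)) * escE W K w)
      (fun y => greenK_ne_top hG K y x)
      (fun y => ENNReal.mul_ne_top ENNReal.ofReal_ne_top (hesc_top y))
      (fun y hy => (hharm y hy).ge) (fun y hy => (hesc_mul _ y hy).le)
      (fun y hy z hz hyz => ?_) w ⟨hw, hwK⟩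
    by_cases hzK : z ∈ K
    · simp [S.greenK_of_mem K hzK]
    · have h1 := hesc z (hBA z fun h => hz ⟨h, hzK⟩) (hnear y hy z hyz).1
      have h2 := (S.greenK_le K z x).trans
        (green_le hG (by linarith) (hnear y hy z hyz).2)
      refine h2.trans (le_trans ?_ (mul_le_mul_right h1 _))
      rw [← ENNReal.ofReal_mul (by positivity)]
      refine ENNReal.ofReal_le_ofReal (le_of_eq ?_)
      rw [Real.div_rpow (by linarith) two_pos.le, Real.rpow_neg two_pos.le]
      field_simp

/-- Entrance laws from points near the boundary are comparable to the equilibrium measure. -/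
theorem entersAt_comparable_equilibrium (hG : W.GreenBounds cg cg') :
    ∃ t₀ c C : ℝ, 4 ≤ t₀ ∧ 0 < c ∧ 0 < C ∧ ∀ (t : ℝ) (x₁ x₂ x : S.E) (K : Set S.E), t₀ ≤ t →
      S.dE x₁ x₂ ≤ 80000 * t → K ⊆ S.ball x₁ (2 * t) ∪ S.ball x₂ (2 * t) →
      4 * t - 1 < S.dE x₁ x → 4 * t - 1 < S.dE x₂ x →
      (S.dE x₁ x ≤ 4 * t + 1 ∨ S.dE x₂ x ≤ 4 * t + 1) → ∀ y ∈ K,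
        ENNReal.ofReal (c * t ^ (-S.ν) * W.equilibrium K y) ≤ W.entersAt x K y ∧
          W.entersAt x K y ≤ ENNReal.ofReal (C * t ^ (-S.ν) * W.equilibrium K y) := by
  obtain ⟨t₀, c, C, ht₀, hc, hC, h⟩ := greenK_comparable_escE hG
  refine ⟨t₀, c, C, ht₀, hc, hC, fun t x₁ x₂ x K ht h12 hK hx₁ hx₂ hx y hy => ?_⟩
  have ht0 : 0 < t := by linarith
  have hτ : 0 < t ^ (-S.ν) := Real.rpow_pos_of_pos ht0 _
  have hxK : x ∉ K := fun hxK => (hK hxK).elim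
    (fun h' : S.dE x₁ x ≤ 2 * t => by linarith) (fun h' : S.dE x₂ x ≤ 2 * t => by linarith)
  have hw : ∀ w, S.ρE w y ≠ 0 → w ∈ S.ball x₁ (3 * t) ∪ S.ball x₂ (3 * t) := by
    intro w hw
    have h1 := S.dE_le_one (S.adjE_of_ρE_ne_zero hw)
    rw [S.dE_comm] at h1
    refine (hK hy).imp (fun h' => ?_) (fun h' => ?_)
    · have h' : S.dE x₁ y ≤ 2 * t := h'
      exact show S.dE x₁ w ≤ 3 * t by linarith [S.dE_triangle x₁ y w]
    · have h' : S.dE x₂ y ≤ 2 * t := h'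
      exact show S.dE x₂ w ≤ 3 * t by linarith [S.dE_triangle x₂ y w]
  rw [ENNReal.ofReal_mul (by positivity), ENNReal.ofReal_mul (q := W.equilibrium K y)
    (by positivity), ofReal_equilibrium W K hy, entersAt_eq W K hxK hy, ← ENNReal.tsum_mul_left,
    ← ENNReal.tsum_mul_left]
  constructor <;> refine ENNReal.tsum_le_tsum fun w => ?_ <;> rw [S.ρE_comm y w] <;>
    by_cases hρ : S.ρE w y = 0
  · simp [hρ]
  · rw [mul_left_comm, mul_comm]
    exact mul_le_mul_left (h t x₁ x₂ x K ht h12 hK hx₁ hx₂ hx w (hw w hρ)).1 _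
  · simp [hρ]
  · rw [mul_left_comm, mul_comm]
    exact mul_le_mul_right (h t x₁ x₂ x K ht h12 hK hx₁ hx₂ hx w (hw w hρ)).2 _

end Core
end GraphSetup

/-- Lemma 2.3: there are constants `c₂ > c₂' > 0` and `c`, depending only on the weighted
graph `G`, such that for `ℓ₀ ≥ c`, `n ≥ 0`, `𝒯 ∈ Λ_{n+1}` with `x₁ = 𝒯(1)`, `x₂ = 𝒯(2)`,
`U = B(x₁, L_{n+1}/1000) ∪ B(x₂, L_{n+1}/1000)`, every
`W̃ ⊆ B(x₁, L_{n+1}/2000) ∪ B(x₂, L_{n+1}/2000)`, every `x ∈ ∂U ∪ ∂_int U` and `x' ∈ W̃`: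
`c₂' L_{n+1}^{-ν} e_{W̃}(x') ≤ P_x[H_{W̃} < ∞, X_{H_{W̃}} = x'] ≤ c₂ L_{n+1}^{-ν} e_{W̃}(x')`. -/
theorem stmt15 (S : GraphSetup) (W : WalkLaw S) (cg cg' : ℝ) (hG : W.GreenBounds cg cg') :
    ∃ c₂ c₂' c : ℝ, 0 < c₂' ∧ c₂' < c₂ ∧
      ∀ ℓ₀ L₀ : ℕ, c ≤ (ℓ₀ : ℝ) → 1 ≤ L₀ → ∀ n : ℕ,
      ∀ T : (k : ℕ) → (Fin k → Bool) → S.E, S.IsTreeEmbed ℓ₀ L₀ (n + 1) T →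
      ∀ x₁ x₂ : S.E, x₁ = T 1 (fun _ => false) → x₂ = T 1 (fun _ => true) →
      ∀ r : ℝ, r = (Lscale ℓ₀ L₀ (n + 1) : ℝ) →
      ∀ U : Set S.E, U = S.ball x₁ (r / 1000) ∪ S.ball x₂ (r / 1000) →
      ∀ Wt : Set S.E, Wt ⊆ S.ball x₁ (r / 2000) ∪ S.ball x₂ (r / 2000) →
      ∀ x ∈ S.vBoundary U ∪ S.intBoundary U, ∀ x' ∈ Wt,
        ENNReal.ofReal (c₂' * r ^ (-S.ν) * W.equilibrium Wt x') ≤ W.entersAt x Wt x' ∧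
          W.entersAt x Wt x' ≤ ENNReal.ofReal (c₂ * r ^ (-S.ν) * W.equilibrium Wt x') := by
  obtain ⟨t₀, c, C, ht₀, hc, hC, h⟩ := entersAt_comparable_equilibrium hG
  have h4 : (0 : ℝ) < 4000 ^ S.ν := Real.rpow_pos_of_pos (by norm_num) _
  refine ⟨(C + c) * 4000 ^ S.ν, c * 4000 ^ S.ν, 4000 * t₀, by positivity, by gcongr; linarith,
    ?_⟩
  rintro ℓ₀ L₀ hℓ₀ hL₀ n T hT x₁ x₂ rfl rfl r rfl U rfl K hK x hx y hy
  set r : ℝ := (Lscale ℓ₀ L₀ (n + 1) : ℝ) with hr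
  set x₁ := T 1 fun _ => false
  set x₂ := T 1 fun _ => true
  set t := r / 4000 with ht
  have hℓ1 : 1 ≤ ℓ₀ := by
    have : (1 : ℝ) ≤ ℓ₀ := by linarith
    exact_mod_cast this
  have hℓr : (ℓ₀ : ℝ) ≤ r := by
    rw [hr, Lscale]
    exact_mod_cast le_trans (Nat.le_self_pow n.succ_ne_zero ℓ₀) (Nat.le_mul_of_pos_right _ hL₀)
  have ht₀t : t₀ ≤ t := by rw [ht]; linarith
  have hr1 : r / 1000 = 4 * t := by rw [ht]; ring
  have hr2 : r / 2000 = 2 * t := by rw [ht]; ring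
  have hrt : r = 4000 * t := by rw [ht]; ring
  have htpow : t ^ (-S.ν) = 4000 ^ S.ν * r ^ (-S.ν) := by
    rw [ht, Real.div_rpow (by linarith) (by norm_num), Real.rpow_neg (x := 4000) (by norm_num),
      div_inv_eq_mul, mul_comm]
  have h12 : S.dE x₁ x₂ ≤ 80000 * t := by
    have hroot : ∀ b : Bool, S.dE (T 0 ![]) (T 1 fun _ => b) ≤ 10 * r := by
      intro b
      have h1 := (hT 0 n.succ_pos ![] b).1
      have h2 : (Fin.snoc ![] b : Fin 1 → Bool) = fun _ => b := by
        ext i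
        fin_cases i
        rfl
      rw [h2] at h1
      refine h1 (show S.dE _ _ ≤ _ from ?_)
      rw [S.dE_self]
      positivity
    have := S.dE_triangle x₁ (T 0 ![]) x₂
    have h1 := hroot false
    have h2 := hroot true
    rw [S.dE_comm] at h1
    linarith
  rw [hr1] at hx
  rw [hr2] at hK
  obtain ⟨hx₁, hx₂, hx'⟩ : 4 * t - 1 < S.dE x₁ x ∧ 4 * t - 1 < S.dE x₂ x ∧
      (S.dE x₁ x ≤ 4 * t + 1 ∨ S.dE x₂ x ≤ 4 * t + 1) := by
    rcases hx with ⟨hxU, z, hz, hxz⟩ | ⟨hxU, z, hz, hxz⟩ <;> have hd := S.dE_le_one hxz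
    · have h1 : 4 * t < S.dE x₁ x := not_le.1 fun h => hxU (Or.inl h)
      have h2 : 4 * t < S.dE x₂ x := not_le.1 fun h => hxU (Or.inr h)
      rw [S.dE_comm] at hd
      refine ⟨by linarith, by linarith, hz.imp (fun h' => ?_) (fun h' => ?_)⟩
      · have h' : S.dE x₁ z ≤ 4 * t := h'
        linarith [S.dE_triangle x₁ z x]
      · have h' : S.dE x₂ z ≤ 4 * t := h'
        linarith [S.dE_triangle x₂ z x]
    · have h1 : 4 * t < S.dE x₁ z := not_le.1 fun h => hz (Or.inl h)
      have h2 : 4 * t < S.dE x₂ z := not_le.1 fun h => hz (Or.inr h)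
      refine ⟨by linarith [S.dE_triangle x₁ x z], by linarith [S.dE_triangle x₂ x z],
        hxU.imp (fun h' => ?_) (fun h' => ?_)⟩
      · exact le_trans h' (by linarith)
      · exact le_trans h' (by linarith)
  obtain ⟨hlow, hup⟩ := h t x₁ x₂ x K ht₀t h12 hK hx₁ hx₂ hx' y hy
  have he : 0 ≤ W.equilibrium K y := by
    rw [WalkLaw.equilibrium, if_pos hy]
    exact mul_nonneg ENNReal.toReal_nonneg (S.ρEpt_pos y).le
  rw [htpow, ← mul_assoc] at hlow hup
  refine ⟨hlow, hup.trans (ENNReal.ofReal_le_ofReal ?_)⟩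
  have : 0 ≤ r := by positivity
  gcongr
  linarith
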